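/- Let k ∈ 2ℕ₀. The category ⟨(∘∘)^{⊗k/2}, ∘∘⊗••⟩ equals {p ∈ NC₂°• : c(p) ∈ kℤ}, where (∘∘)^{⊗k/2} denotes the k/2-fold tensor power of the unicolored white pair partition (the empty partition for k = 0). In particular, these categories are pairwise different for different values of k ∈ 2ℕ₀. -/

import Mathlib

noncomputable section
namespace CTCP

/-- Colors of points: `true` = white (∘), `false` = black (•). -/
abbrev Color := Bool

def white : Color := true
def black : Color := false

/-- A two-colored partition with `k` upper and `l` lower points.  The block
structure is recorded as a setoid on the disjoint union of the points. -/
structure TCP where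
  k : ℕ
  l : ℕ
  upColor : Fin k → Color
  lowColor : Fin l → Color
  rel : Setoid (Fin k ⊕ Fin l)

/-- The disjoint union of two equivalence relations. -/
def sumRel {α β : Type*} (r : Setoid α) (s : Setoid β) : (α ⊕ β) → (α ⊕ β) → Prop
  | .inl a, .inl b => r.r a b
  | .inr a, .inr b => s.r a b
  | _, _ => False

def sumSetoid {α β : Type*} (r : Setoid α) (s : Setoid β) : Setoid (α ⊕ β) where
  r := sumRel r s
  iseqv := by
    constructor
    · rintro (a | a)
      · exact r.iseqv.refl a
      · exact s.iseqv.refl a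
    · rintro (a | a) (b | b) h
      · exact r.iseqv.symm h
      · exact h.elim
      · exact h.elim
      · exact s.iseqv.symm h
    · rintro (a | a) (b | b) (c | c) h₁ h₂
      all_goals first
        | exact r.iseqv.trans h₁ h₂
        | exact s.iseqv.trans h₁ h₂
        | exact h₁.elim
        | exact h₂.elim

def splitPt (p q : TCP) :
    (Fin (p.k + q.k) ⊕ Fin (p.l + q.l)) → ((Fin p.k ⊕ Fin p.l) ⊕ (Fin q.k ⊕ Fin q.l))
  | .inl i => (finSumFinEquiv.symm i).elim (fun a => .inl (.inl a)) (fun b => .inr (.inl b))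
  | .inr j => (finSumFinEquiv.symm j).elim (fun a => .inl (.inr a)) (fun b => .inr (.inr b))

/-- Tensor product (horizontal concatenation) of two-colored partitions. -/
def tensor (p q : TCP) : TCP where
  k := p.k + q.k
  l := p.l + q.l
  upColor := fun i => (finSumFinEquiv.symm i).elim p.upColor q.upColor
  lowColor := fun j => (finSumFinEquiv.symm j).elim p.lowColor q.lowColor
  rel := Setoid.comap (splitPt p q) (sumSetoid p.rel q.rel)

def compEmbMid (q p : TCP) (h : q.l = p.k) :
    (Fin p.k ⊕ Fin p.l) → ((Fin q.k ⊕ Fin q.l) ⊕ Fin p.l)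
  | .inl i => .inl (.inr (Fin.cast h.symm i))
  | .inr j => .inr j

/-- The relation generating the blocks of the composition of `q` and `p`:
the blocks of `q` together with the blocks of `p`, glued along the middle row. -/
def compRel (q p : TCP) (h : q.l = p.k) :
    ((Fin q.k ⊕ Fin q.l) ⊕ Fin p.l) → ((Fin q.k ⊕ Fin q.l) ⊕ Fin p.l) → Prop :=
  fun t t' =>
    (∃ x y, q.rel.r x y ∧ t = .inl x ∧ t' = .inl y) ∨
    (∃ x y, p.rel.r x y ∧ t = compEmbMid q p h x ∧ t' = compEmbMid q p h y)

/-- Composition (vertical concatenation) of `q ∈ P(k,l)` with `p ∈ P(l,m)`: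
blocks are joined through the middle points, which are then deleted. -/
def comp (q p : TCP) (h : q.l = p.k) : TCP where
  k := q.k
  l := p.l
  upColor := q.upColor
  lowColor := p.lowColor
  rel := Setoid.comap
    (Sum.elim (fun i : Fin q.k => (Sum.inl (Sum.inl i) : (Fin q.k ⊕ Fin q.l) ⊕ Fin p.l))
      (fun j : Fin p.l => Sum.inr j))
    (Relation.EqvGen.setoid (compRel q p h))

/-- The colors of the lower row of `q` match the colors of the upper row of `p`. -/
def ColorsMatch (q p : TCP) (h : q.l = p.k) : Prop :=
  ∀ j : Fin q.l, q.lowColor j = p.upColor (Fin.cast h j)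

/-- Involution: reflection at the horizontal axis. -/
def invol (p : TCP) : TCP where
  k := p.l
  l := p.k
  upColor := p.lowColor
  lowColor := p.upColor
  rel := Setoid.comap Sum.swap p.rel

/-- Vertical reflection: reflection at the vertical axis. -/
def vref (p : TCP) : TCP where
  k := p.k
  l := p.l
  upColor := fun i => p.upColor i.rev
  lowColor := fun j => p.lowColor j.rev
  rel := Setoid.comap (Sum.map Fin.rev Fin.rev) p.rel

/-- Inversion of colors. -/
def cinv (p : TCP) : TCP where
  k := p.k
  l := p.l
  upColor := fun i => !(p.upColor i)
  lowColor := fun j => !(p.lowColor j)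
  rel := p.rel

/-- Verticolor reflection `p̃`: vertical reflection combined with color inversion. -/
def vcref (p : TCP) : TCP := cinv (vref p)

/-- Rotation of the leftmost upper point to the left end of the lower row
(inverting its color). -/
def rotULdown (p : TCP) (h : 0 < p.k) : TCP where
  k := p.k - 1
  l := p.l + 1
  upColor := fun i => p.upColor ⟨i.1 + 1, by have := i.2; omega⟩
  lowColor := fun j =>
    if hj : j.1 = 0 then !(p.upColor ⟨0, h⟩)
    else p.lowColor ⟨j.1 - 1, by have := j.2; omega⟩
  rel := Setoid.comap
    (Sum.elim
      (fun i : Fin (p.k - 1) => (Sum.inl ⟨i.1 + 1, by have := i.2; omega⟩ : Fin p.k ⊕ Fin p.l))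
      (fun j : Fin (p.l + 1) =>
        if hj : j.1 = 0 then Sum.inl ⟨0, h⟩
        else Sum.inr ⟨j.1 - 1, by have := j.2; omega⟩))
    p.rel

/-- Rotation of the rightmost upper point to the right end of the lower row
(inverting its color). -/
def rotURdown (p : TCP) (h : 0 < p.k) : TCP where
  k := p.k - 1
  l := p.l + 1
  upColor := fun i => p.upColor ⟨i.1, by have := i.2; omega⟩
  lowColor := fun j =>
    if hj : j.1 < p.l then p.lowColor ⟨j.1, hj⟩
    else !(p.upColor ⟨p.k - 1, by omega⟩)
  rel := Setoid.comap
    (Sum.elim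
      (fun i : Fin (p.k - 1) => (Sum.inl ⟨i.1, by have := i.2; omega⟩ : Fin p.k ⊕ Fin p.l))
      (fun j : Fin (p.l + 1) =>
        if hj : j.1 < p.l then Sum.inr ⟨j.1, hj⟩
        else Sum.inl ⟨p.k - 1, by omega⟩))
    p.rel

/-- Rotation of the leftmost lower point to the left end of the upper row
(inverting its color). -/
def rotULup (p : TCP) (h : 0 < p.l) : TCP where
  k := p.k + 1
  l := p.l - 1
  upColor := fun i =>
    if hi : i.1 = 0 then !(p.lowColor ⟨0, h⟩)
    else p.upColor ⟨i.1 - 1, by have := i.2; omega⟩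
  lowColor := fun j => p.lowColor ⟨j.1 + 1, by have := j.2; omega⟩
  rel := Setoid.comap
    (Sum.elim
      (fun i : Fin (p.k + 1) =>
        if hi : i.1 = 0 then (Sum.inr ⟨0, h⟩ : Fin p.k ⊕ Fin p.l)
        else Sum.inl ⟨i.1 - 1, by have := i.2; omega⟩)
      (fun j : Fin (p.l - 1) => Sum.inr ⟨j.1 + 1, by have := j.2; omega⟩))
    p.rel

/-- Rotation of the rightmost lower point to the right end of the upper row
(inverting its color). -/
def rotURup (p : TCP) (h : 0 < p.l) : TCP where
  k := p.k + 1
  l := p.l - 1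
  upColor := fun i =>
    if hi : i.1 < p.k then p.upColor ⟨i.1, hi⟩
    else !(p.lowColor ⟨p.l - 1, by omega⟩)
  lowColor := fun j => p.lowColor ⟨j.1, by have := j.2; omega⟩
  rel := Setoid.comap
    (Sum.elim
      (fun i : Fin (p.k + 1) =>
        if hi : i.1 < p.k then (Sum.inl ⟨i.1, hi⟩ : Fin p.k ⊕ Fin p.l)
        else Sum.inr ⟨p.l - 1, by omega⟩)
      (fun j : Fin (p.l - 1) => Sum.inr ⟨j.1, by have := j.2; omega⟩))
    p.rel

/-- `p'` is obtained from `p` by rotating an outermost point of one row to the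
corresponding end of the other row, inverting its color. -/
def IsRotationOf (p' p : TCP) : Prop :=
  (∃ h : 0 < p.k, p' = rotULdown p h) ∨ (∃ h : 0 < p.k, p' = rotURdown p h) ∨
  (∃ h : 0 < p.l, p' = rotULup p h) ∨ (∃ h : 0 < p.l, p' = rotURup p h)

/-- A partition with no upper points, given by colors and block labels. -/
def mkLower (n : ℕ) (color : Fin n → Color) (lbl : Fin n → ℕ) : TCP where
  k := 0
  l := n
  upColor := Fin.elim0
  lowColor := color
  rel := Setoid.ker (Sum.elim Fin.elim0 lbl)

/-- The identity partition of color `c`. -/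
def idPart (c : Color) : TCP where
  k := 1
  l := 1
  upColor := fun _ => c
  lowColor := fun _ => c
  rel := ⊤

/-- The pair partition on two lower points of colors `c₁`, `c₂`. -/
def pairLower (c₁ c₂ : Color) : TCP := mkLower 2 ![c₁, c₂] (fun _ => 0)

/-- The singleton of color `c`. -/
def singl (c : Color) : TCP := mkLower 1 (fun _ => c) (fun _ => 0)

/-- `bPart s` : one block on `s` white lower points (`bPart 0` is the empty partition). -/
def bPart (s : ℕ) : TCP := mkLower s (fun _ => white) (fun _ => 0)

/-- One block on four lower points with the given colors. -/
def fourBlock (c₁ c₂ c₃ c₄ : Color) : TCP := mkLower 4 ![c₁, c₂, c₃, c₄] (fun _ => 0)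

/-- The four-block ∘•∘•. -/
def fourWBWB : TCP := fourBlock white black white black

/-- The four-block ∘∘••. -/
def fourWWBB : TCP := fourBlock white white black black

/-- The empty partition. -/
def emptyPart : TCP := mkLower 0 Fin.elim0 Fin.elim0

/-- The partition ∘⊗• (a white and a black singleton). -/
def singPair : TCP := tensor (singl white) (singl black)

/-- The partition ∘∘⊗••. -/
def wwbb : TCP := tensor (pairLower white white) (pairLower black black)

/-- The crossing partition `X` on four white points: first upper point connected to the
second lower point, second upper point connected to the first lower point. -/
def crossPart : TCP where
  k := 2
  l := 2
  upColor := fun _ => white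
  lowColor := fun _ => white
  rel := Setoid.ker (Sum.elim (fun i : Fin 2 => (i.1 : ℕ)) (fun j : Fin 2 => 1 - j.1))

/-- `n`-fold tensor power. -/
def tensorPow (p : TCP) : ℕ → TCP
  | 0 => emptyPart
  | n + 1 => tensor (tensorPow p n) p

/-- The partition `p_d`: from left to right, `d` white singletons, a white point, `d` black
singletons and a black point, the two non-singleton points forming a pair block. -/
def pPart (d : ℕ) : TCP :=
  mkLower (2 * d + 2) (fun j => decide (j.1 ≤ d))
    (fun j => if j.1 = d ∨ j.1 = 2 * d + 1 then 0 else j.1 + 1)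

/-- The partition `p′_r`: from left to right, `r+1` white singletons, a black point, `r−1`
black singletons and a black point, the black non-singleton points forming a pair block;
for `r = 0` the middle consists of one white singleton instead. -/
def pPrime (r : ℕ) : TCP :=
  if r = 0 then
    mkLower 4 ![white, black, white, black]
      (fun j => if j.1 = 1 ∨ j.1 = 3 then 0 else j.1 + 1)
  else
    mkLower (2 * r + 2) (fun j => decide (j.1 ≤ r))
      (fun j => if j.1 = r + 1 ∨ j.1 = 2 * r + 1 then 0 else j.1 + 1)

/-- A category of two-colored partitions: a class of two-colored partitions closed under
tensor products, composition (when defined) and involution, containing both bicolored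
pair partitions and both identity partitions. -/
structure IsCategory (C : Set TCP) : Prop where
  tensor_mem : ∀ p ∈ C, ∀ q ∈ C, tensor p q ∈ C
  comp_mem : ∀ q ∈ C, ∀ p ∈ C, ∀ h : q.l = p.k, ColorsMatch q p h → comp q p h ∈ C
  invol_mem : ∀ p ∈ C, invol p ∈ C
  idw_mem : idPart white ∈ C
  idb_mem : idPart black ∈ C
  pairwb_mem : pairLower white black ∈ C
  pairbw_mem : pairLower black white ∈ C

/-- The smallest category of partitions containing `S`. -/
def generated (S : Set TCP) : Set TCP :=
  {p | ∀ C : Set TCP, IsCategory C → S ⊆ C → p ∈ C}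

/-- `c(p)` : (white lower points + black upper points) − (black lower points + white upper
points). -/
def cval (p : TCP) : ℤ :=
  ((Nat.card {j : Fin p.l // p.lowColor j = white} +
      Nat.card {i : Fin p.k // p.upColor i = black} : ℕ) : ℤ) -
    ((Nat.card {j : Fin p.l // p.lowColor j = black} +
      Nat.card {i : Fin p.k // p.upColor i = white} : ℕ) : ℤ)

/-- Position of a point on the line obtained by rotating all upper points down to the
left of the lower row. -/
def linePos (p : TCP) : (Fin p.k ⊕ Fin p.l) → ℕ :=
  Sum.elim (fun i => p.k - 1 - i.1) (fun j => p.k + j.1)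

/-- A partition is noncrossing if its strings can be drawn without crossings. -/
def Noncrossing (p : TCP) : Prop :=
  ∀ a b x y : Fin p.k ⊕ Fin p.l,
    linePos p a < linePos p b → linePos p b < linePos p x → linePos p x < linePos p y →
    p.rel.r a x → p.rel.r b y → p.rel.r a b

/-- The number of points in the block of the point `x`. -/
def blockSize (p : TCP) (x : Fin p.k ⊕ Fin p.l) : ℕ := Nat.card {y // p.rel.r x y}

/-- The partition obtained from `p` by rotating all upper points down, so that it has no
upper points. -/
def toLine (p : TCP) : TCP where
  k := 0
  l := p.k + p.l
  upColor := Fin.elim0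
  lowColor := fun j =>
    if hj : j.1 < p.k then !(p.upColor ⟨p.k - 1 - j.1, by omega⟩)
    else p.lowColor ⟨j.1 - p.k, by have := j.2; omega⟩
  rel := Setoid.comap
    (Sum.elim (fun i : Fin 0 => (Fin.elim0 i : Fin p.k ⊕ Fin p.l))
      (fun j : Fin (p.k + p.l) =>
        if hj : j.1 < p.k then Sum.inl ⟨p.k - 1 - j.1, by omega⟩
        else Sum.inr ⟨j.1 - p.k, by have := j.2; omega⟩))
    p.rel

def eraseLowRel (p : TCP) (j : ℕ) (hj : j + 1 < p.l) :
    (Fin p.k ⊕ Fin p.l) → (Fin p.k ⊕ Fin p.l) → Prop :=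
  fun x y => p.rel.r x y ∨ (x = Sum.inr ⟨j, by omega⟩ ∧ y = Sum.inr ⟨j + 1, hj⟩)

/-- Erasing the `j`-th and `(j+1)`-th lower points of `p`, first joining their blocks. -/
def eraseLowerPair (p : TCP) (j : ℕ) (hj : j + 1 < p.l) : TCP where
  k := p.k
  l := p.l - 2
  upColor := p.upColor
  lowColor := fun m =>
    if hm : m.1 < j then p.lowColor ⟨m.1, by omega⟩
    else p.lowColor ⟨m.1 + 2, by have := m.2; omega⟩
  rel := Setoid.comap
    (Sum.elim (fun i : Fin p.k => (Sum.inl i : Fin p.k ⊕ Fin p.l))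
      (fun m : Fin (p.l - 2) =>
        if hm : m.1 < j then Sum.inr ⟨m.1, by omega⟩
        else Sum.inr ⟨m.1 + 2, by have := m.2; omega⟩))
    (Relation.EqvGen.setoid (eraseLowRel p j hj))

def eraseUpRel (p : TCP) (j : ℕ) (hj : j + 1 < p.k) :
    (Fin p.k ⊕ Fin p.l) → (Fin p.k ⊕ Fin p.l) → Prop :=
  fun x y => p.rel.r x y ∨ (x = Sum.inl ⟨j, by omega⟩ ∧ y = Sum.inl ⟨j + 1, hj⟩)

/-- Erasing the `j`-th and `(j+1)`-th upper points of `p`, first joining their blocks. -/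
def eraseUpperPair (p : TCP) (j : ℕ) (hj : j + 1 < p.k) : TCP where
  k := p.k - 2
  l := p.l
  upColor := fun m =>
    if hm : m.1 < j then p.upColor ⟨m.1, by omega⟩
    else p.upColor ⟨m.1 + 2, by have := m.2; omega⟩
  lowColor := p.lowColor
  rel := Setoid.comap
    (Sum.elim
      (fun m : Fin (p.k - 2) =>
        if hm : m.1 < j then (Sum.inl ⟨m.1, by omega⟩ : Fin p.k ⊕ Fin p.l)
        else Sum.inl ⟨m.1 + 2, by have := m.2; omega⟩)
      (fun i : Fin p.l => Sum.inr i))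
    (Relation.EqvGen.setoid (eraseUpRel p j hj))

/-- `p₁ ⊗ p₂ ∈ C` is in nest decomposed form, with the first point of `p₂` colored `x`
and the last point of `p₂` colored `y` (and those two points in the same block). -/
def InNDF (C : Set TCP) (x y : Color) (p₁ p₂ : TCP) : Prop :=
  tensor p₁ p₂ ∈ C ∧ Noncrossing (tensor p₁ p₂) ∧ p₁.k = 0 ∧ p₂.k = 0 ∧ 0 < p₁.l ∧
    ∃ h : 2 ≤ p₂.l,
      p₂.lowColor ⟨0, by omega⟩ = x ∧ p₂.lowColor ⟨p₂.l - 1, by omega⟩ = y ∧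
      p₂.rel.r (Sum.inr ⟨0, by omega⟩) (Sum.inr ⟨p₂.l - 1, by omega⟩)

/-- `K^C(x,y)`: the set of values `c(p₁)` over nest decomposed forms `p₁ ⊗ p₂ ∈ C` whose
outer block starts with color `x` and ends with color `y`. -/
def Kset (C : Set TCP) (x y : Color) : Set ℤ :=
  {n | ∃ p₁ p₂, InNDF C x y p₁ p₂ ∧ cval p₁ = n}

/-- The degree of reflection `k(C)`. -/
def kdeg (C : Set TCP) : ℕ := sInf {n : ℕ | 0 < n ∧ ∃ p ∈ C, cval p = (n : ℤ)}

/-- The local parameter `d(C)`. -/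
def ddeg (C : Set TCP) : ℕ := sInf {n : ℕ | 0 < n ∧ (n : ℤ) ∈ Kset C white black}

/-- The local parameter `r(C) = min {t ≥ 1 | t ∈ K^C(•,•)} − 1`. -/
def rdeg (C : Set TCP) : ℕ := sInf {t : ℕ | 1 ≤ t ∧ (t : ℤ) ∈ Kset C black black} - 1

/-- `C` is globally colorized if it contains `∘∘ ⊗ ••`. -/
def GloballyColorized (C : Set TCP) : Prop := wwbb ∈ C

def CaseO (C : Set TCP) : Prop := singPair ∉ C ∧ fourWBWB ∉ C
def CaseB (C : Set TCP) : Prop := singPair ∈ C ∧ fourWBWB ∉ C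
def CaseH (C : Set TCP) : Prop := singPair ∉ C ∧ fourWBWB ∈ C
def CaseS (C : Set TCP) : Prop := singPair ∈ C ∧ fourWBWB ∈ C

/-! Non-colored partitions. -/

/-- A non-colored partition with `k` upper and `l` lower points. -/
structure NCP where
  k : ℕ
  l : ℕ
  rel : Setoid (Fin k ⊕ Fin l)

namespace NCP

def splitPt (p q : NCP) :
    (Fin (p.k + q.k) ⊕ Fin (p.l + q.l)) → ((Fin p.k ⊕ Fin p.l) ⊕ (Fin q.k ⊕ Fin q.l))
  | .inl i => (finSumFinEquiv.symm i).elim (fun a => .inl (.inl a)) (fun b => .inr (.inl b))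
  | .inr j => (finSumFinEquiv.symm j).elim (fun a => .inl (.inr a)) (fun b => .inr (.inr b))

def tensor (p q : NCP) : NCP where
  k := p.k + q.k
  l := p.l + q.l
  rel := Setoid.comap (splitPt p q) (sumSetoid p.rel q.rel)

def compEmbMid (q p : NCP) (h : q.l = p.k) :
    (Fin p.k ⊕ Fin p.l) → ((Fin q.k ⊕ Fin q.l) ⊕ Fin p.l)
  | .inl i => .inl (.inr (Fin.cast h.symm i))
  | .inr j => .inr j

def compRel (q p : NCP) (h : q.l = p.k) :
    ((Fin q.k ⊕ Fin q.l) ⊕ Fin p.l) → ((Fin q.k ⊕ Fin q.l) ⊕ Fin p.l) → Prop :=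
  fun t t' =>
    (∃ x y, q.rel.r x y ∧ t = .inl x ∧ t' = .inl y) ∨
    (∃ x y, p.rel.r x y ∧ t = compEmbMid q p h x ∧ t' = compEmbMid q p h y)

def comp (q p : NCP) (h : q.l = p.k) : NCP where
  k := q.k
  l := p.l
  rel := Setoid.comap
    (Sum.elim (fun i : Fin q.k => (Sum.inl (Sum.inl i) : (Fin q.k ⊕ Fin q.l) ⊕ Fin p.l))
      (fun j : Fin p.l => Sum.inr j))
    (Relation.EqvGen.setoid (compRel q p h))

def invol (p : NCP) : NCP where
  k := p.l
  l := p.k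
  rel := Setoid.comap Sum.swap p.rel

/-- The non-colored identity partition. -/
def idN : NCP := ⟨1, 1, ⊤⟩

/-- The non-colored pair partition on two lower points. -/
def pairN : NCP := ⟨0, 2, ⊤⟩

end NCP

/-- A category of non-colored partitions. -/
structure IsCategoryN (D : Set NCP) : Prop where
  tensor_mem : ∀ p ∈ D, ∀ q ∈ D, NCP.tensor p q ∈ D
  comp_mem : ∀ q ∈ D, ∀ p ∈ D, ∀ h : q.l = p.k, NCP.comp q p h ∈ D
  invol_mem : ∀ p ∈ D, NCP.invol p ∈ D
  id_mem : NCP.idN ∈ D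
  pair_mem : NCP.pairN ∈ D

/-- The map `Ψ` forgetting the colors of a two-colored partition. -/
def forget (p : TCP) : NCP := ⟨p.k, p.l, p.rel⟩

/-! ### Setoids all of whose classes have two elements -/

/-- Every class of the setoid has exactly two elements. -/
def IsPairing {α : Type*} (r : Setoid α) : Prop :=
  ∀ x, ∃ y, y ≠ x ∧ ∀ z, r x z ↔ z = x ∨ z = y

theorem isPairing_iff_blockSize (p : TCP) : IsPairing p.rel ↔ ∀ x, blockSize p x = 2 := by
  refine forall_congr' fun x => ?_
  change _ ↔ Set.ncard {y | p.rel x y} = 2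
  rw [Set.ncard_eq_two]
  constructor
  · rintro ⟨y, hy, h⟩
    exact ⟨x, y, hy.symm, Set.ext fun z => by simp [h]⟩
  · rintro ⟨a, b, hab, h⟩
    have hm : ∀ z, p.rel x z ↔ z = a ∨ z = b := fun z => by
      simpa using Set.ext_iff.1 h z
    rcases (hm x).1 (p.rel.refl x) with rfl | rfl
    · exact ⟨b, hab.symm, hm⟩
    · exact ⟨a, hab, fun z => (hm z).trans or_comm⟩

theorem IsPairing.exists_involution {α : Type*} {r : Setoid α} (h : IsPairing r) :
    ∃ σ : α → α, Function.Involutive σ ∧ (∀ x, σ x ≠ x) ∧ ∀ x y, r x y ↔ y = x ∨ y = σ x := by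
  choose σ hne hσ using h
  refine ⟨σ, fun x => ?_, hne, hσ⟩
  have h1 : r (σ x) x := r.symm ((hσ x _).2 (Or.inr rfl))
  rcases (hσ _ _).1 h1 with h2 | h2
  · exact absurd h2.symm (hne x)
  · exact h2.symm

theorem IsPairing.comap {α β : Type*} {r : Setoid β} (h : IsPairing r) {e : α → β}
    (he : Function.Injective e) (hr : ∀ a b, r (e a) b → b ∈ Set.range e) :
    IsPairing (Setoid.comap e r) := by
  intro x
  obtain ⟨y, hy, hxy⟩ := h (e x)
  obtain ⟨y', rfl⟩ := hr x y ((hxy y).2 (Or.inr rfl))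
  refine ⟨y', fun h => hy (by rw [h]), fun z => ?_⟩
  rw [Setoid.comap_rel, hxy, he.eq_iff, he.eq_iff]

theorem IsPairing.eq_of_le {α : Type*} {r s : Setoid α} (hr : IsPairing r) (hs : IsPairing s)
    (h : ∀ x y, r x y → s x y) : r = s := by
  refine Setoid.ext fun x y => ⟨h x y, fun hxy => ?_⟩
  obtain ⟨a, ha, hra⟩ := hr x
  obtain ⟨b, hb, hsb⟩ := hs x
  have hab : a = b := ((hsb a).1 (h _ _ ((hra a).2 (Or.inr rfl)))).resolve_left ha
  rw [hra, hab, ← hsb]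
  exact hxy

theorem IsPairing.sumSetoid {α β : Type*} {r : Setoid α} {s : Setoid β} (hr : IsPairing r)
    (hs : IsPairing s) : IsPairing (sumSetoid r s) := by
  rintro (x | x)
  · obtain ⟨y, hy, h⟩ := hr x
    refine ⟨.inl y, by simpa using hy, ?_⟩
    rintro (z | z)
    · simp only [Sum.inl.injEq]
      exact h z
    · exact ⟨fun h => h.elim, by simp⟩
  · obtain ⟨y, hy, h⟩ := hs x
    refine ⟨.inr y, by simpa using hy, ?_⟩
    rintro (z | z)
    · exact ⟨fun h => h.elim, by simp⟩
    · simp only [Sum.inr.injEq]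
      exact h z

theorem splitPt_bijective (p q : TCP) : Function.Bijective (splitPt p q) := by
  constructor
  · rintro (i | i) (j | j)
    all_goals
      simp only [splitPt]
      obtain ⟨i, rfl⟩ := finSumFinEquiv.surjective i
      obtain ⟨j, rfl⟩ := finSumFinEquiv.surjective j
      rcases i with i | i <;> rcases j with j | j <;> simp
  · rintro ((i | i) | (i | i))
    · exact ⟨.inl (finSumFinEquiv (.inl i)), by simp [splitPt]⟩
    · exact ⟨.inr (finSumFinEquiv (.inl i)), by simp [splitPt]⟩
    · exact ⟨.inl (finSumFinEquiv (.inr i)), by simp [splitPt]⟩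
    · exact ⟨.inr (finSumFinEquiv (.inr i)), by simp [splitPt]⟩

theorem IsPairing.tensor {p q : TCP} (hp : IsPairing p.rel) (hq : IsPairing q.rel) :
    IsPairing (tensor p q).rel :=
  (hp.sumSetoid hq).comap (splitPt_bijective p q).1
    fun _ b _ => (splitPt_bijective p q).2 b

theorem IsPairing.invol {p : TCP} (hp : IsPairing p.rel) : IsPairing (invol p).rel :=
  hp.comap Sum.swap_leftInverse.injective fun _ b _ => ⟨b.swap, Sum.swap_swap b⟩

/-! ### Orbits of two involutions -/

section Dihedral

variable {T : Type*} {α β : Equiv.Perm T}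

theorem involution_apply_zpow (hα : ∀ x, α (α x) = x) (hβ : ∀ x, β (β x) = x) {x : T}
    (hx : β x = x) (n : ℤ) : β (((α * β) ^ n) x) = ((α * β) ^ (-n)) x := by
  have hα' : α⁻¹ = α := inv_eq_of_mul_eq_one_left (Equiv.ext hα)
  have hβ' : β⁻¹ = β := inv_eq_of_mul_eq_one_left (Equiv.ext hβ)
  have h : β * (α * β) * β⁻¹ = (α * β)⁻¹ := by rw [mul_inv_rev, hα', hβ', mul_assoc, mul_assoc,
    show β * β = 1 from Equiv.ext hβ, mul_one]
  have h2 : β * (α * β) ^ n * β⁻¹ = (α * β) ^ (-n) := by rw [← conj_zpow, h, inv_zpow, zpow_neg]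
  rw [← h2]
  simp [hβ', hx]

theorem involution_apply_zpow' (hα : ∀ x, α (α x) = x) (hβ : ∀ x, β (β x) = x) {x : T}
    (hx : β x = x) (n : ℤ) : α (((α * β) ^ n) x) = ((α * β) ^ (1 - n)) x := by
  have h := involution_apply_zpow hα hβ hx n
  have h1 : ((α * β) ^ n) x = β (((α * β) ^ (-n)) x) := by rw [← h, hβ]
  rw [h1, sub_eq_add_neg, zpow_add, zpow_one]
  rfl

/-- The orbit under two involutions of a fixed point of one of them contains exactly one other
fixed point. -/
theorem exists_unique_other_fixed [Finite T] (hα : ∀ x, α (α x) = x) (hβ : ∀ x, β (β x) = x)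
    (h : ∀ x, ¬ (α x = x ∧ β x = x)) {x : T} (hx : β x = x) {r : Setoid T}
    (hr : ∀ s : Setoid T, r ≤ s ↔ ∀ x, s x (α x) ∧ s x (β x)) :
    ∃ y, y ≠ x ∧ (α y = y ∨ β y = y) ∧ r x y ∧
      ∀ z, (α z = z ∨ β z = z) → r x z → z = x ∨ z = y := by
  set π := α * β with hπ
  have hrr := (hr r).1 le_rfl
  have key : ∀ n : ℤ, (π ^ n) x = x ↔ (Function.minimalPeriod (π • ·) x : ℤ) ∣ n := fun n =>
    MulAction.zpow_smul_eq_iff_minimalPeriod_dvd (a := π) (b := x)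
  set N := Function.minimalPeriod (π • ·) x with hN
  have key2 : ∀ m n : ℤ, (π ^ m) x = (π ^ n) x ↔ (N : ℤ) ∣ m - n := fun m n => by
    rw [← key, sub_eq_neg_add, zpow_add, Equiv.Perm.mul_apply, zpow_neg, Equiv.Perm.inv_eq_iff_eq,
      eq_comm]
  have hNpos : 0 < N := by
    apply Function.minimalPeriod_pos_of_mem_periodicPts
    exact (Equiv.injective π).mem_periodicPts x
  have hN1 : N ≠ 1 := by
    intro h1
    have h2 : (π ^ (1 : ℤ)) x = x := (key 1).2 (by simp [h1])
    refine h x ⟨?_, hx⟩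
    rw [zpow_one, hπ, Equiv.Perm.mul_apply, hx] at h2
    exact h2
  have hfix : ∀ n : ℤ, (α ((π ^ n) x) = (π ^ n) x ∨ β ((π ^ n) x) = (π ^ n) x) ↔
      (N : ℤ) ∣ 1 - n - n ∨ (N : ℤ) ∣ -n - n := fun n => by
    rw [involution_apply_zpow' hα hβ hx, involution_apply_zpow hα hβ hx, key2, key2]
  have hπr : ∀ t, r t (π t) := fun t => r.trans (hrr t).2 (hrr _).1
  have horb : ∀ n : ℤ, r x ((π ^ n) x) := by
    intro n
    induction n using Int.induction_on with
    | zero => exact r.refl x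
    | succ n ih =>
      rw [add_comm, zpow_add, zpow_one]
      exact r.trans ih (hπr _)
    | pred n ih =>
      refine r.trans ih (r.symm ?_)
      have h1 := hπr ((π ^ (-(n : ℤ) - 1)) x)
      rwa [← Equiv.Perm.mul_apply, ← zpow_one_add, add_sub_cancel] at h1
  have hclosed : ∀ z, r x z → ∃ n : ℤ, z = (π ^ n) x := by
    let s : Setoid T := Setoid.ker fun z => ∃ n : ℤ, z = (π ^ n) x
    have hs : r ≤ s := by
      have hα1 : ∀ z, (∃ n : ℤ, z = (π ^ n) x) → ∃ n : ℤ, α z = (π ^ n) x := by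
        rintro _ ⟨n, rfl⟩
        exact ⟨1 - n, involution_apply_zpow' hα hβ hx n⟩
      have hβ1 : ∀ z, (∃ n : ℤ, z = (π ^ n) x) → ∃ n : ℤ, β z = (π ^ n) x := by
        rintro _ ⟨n, rfl⟩
        exact ⟨-n, involution_apply_zpow hα hβ hx n⟩
      refine (hr s).2 fun z => ⟨propext ⟨hα1 z, fun h => ?_⟩, propext ⟨hβ1 z, fun h => ?_⟩⟩
      · simpa [hα] using hα1 _ h
      · simpa [hβ] using hβ1 _ h
    intro z hz
    have h1 : (∃ n : ℤ, x = (π ^ n) x) = ∃ n : ℤ, z = (π ^ n) x := hs hz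
    rw [← h1]
    exact ⟨0, by simp⟩
  obtain ⟨m, hm⟩ : ∃ m : ℕ, N = 2 * m ∨ N + 1 = 2 * m := by
    rcases Nat.even_or_odd' N with ⟨c, hc | hc⟩
    · exact ⟨c, Or.inl hc⟩
    · exact ⟨c + 1, Or.inr (by omega)⟩
  have hmfix : (N : ℤ) ∣ 1 - (m : ℤ) - m ∨ (N : ℤ) ∣ -(m : ℤ) - m := by
    rcases hm with hm | hm
    · exact Or.inr ⟨-1, by omega⟩
    · exact Or.inl ⟨-1, by omega⟩
  refine ⟨(π ^ (m : ℤ)) x, ?_, (hfix _).2 hmfix, horb _, ?_⟩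
  · rw [Ne, key]
    intro hd
    have := Int.le_of_dvd (by omega) hd
    omega
  · rintro z hz hxz
    obtain ⟨n, rfl⟩ := hclosed z hxz
    rw [hfix] at hz
    rw [key, key2]
    rcases hm with hm | hm <;> rcases hz with ⟨c, hc⟩ | ⟨c, hc⟩
    · exfalso
      have : (N : ℤ) * c = 2 * (m * c) := by rw [hm]; push_cast; ring
      omega
    · have h2 : (N : ℤ) * c = 2 * (m * c) := by rw [hm]; push_cast; ring
      have h3 : n = -(m * c) := by omega
      rcases Int.even_or_odd' c with ⟨d, rfl | rfl⟩
      · exact Or.inl ⟨-d, by rw [h3, hm]; push_cast; ring⟩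
      · exact Or.inr ⟨-d - 1, by rw [h3, hm]; push_cast; ring⟩
    · have h4 : (N : ℤ) = 2 * m - 1 := by omega
      rw [h4] at hc ⊢
      obtain ⟨e, rfl⟩ : ∃ e, c = 2 * e + 1 := ⟨m * c + n - 1, by linarith⟩
      exact Or.inr ⟨-e - 1, by linarith⟩
    · have h4 : (N : ℤ) = 2 * m - 1 := by omega
      rw [h4] at hc ⊢
      obtain ⟨e, rfl⟩ : ∃ e, c = 2 * e := ⟨m * c + n, by linarith⟩
      exact Or.inl ⟨-e, by linarith⟩

end Dihedral

/-! ### Composition -/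

/-- The setoid on upper, middle and lower points whose restriction is the composition. -/
def glue (q p : TCP) (h : q.l = p.k) : Setoid ((Fin q.k ⊕ Fin q.l) ⊕ Fin p.l) :=
  Relation.EqvGen.setoid (compRel q p h)

/-- The embedding of the points of the composition into the glued points. -/
def outer (q p : TCP) : Fin q.k ⊕ Fin p.l → (Fin q.k ⊕ Fin q.l) ⊕ Fin p.l :=
  Sum.elim (fun i => .inl (.inl i)) (fun j => .inr j)

theorem comp_rel (q p : TCP) (h : q.l = p.k) (x y : Fin q.k ⊕ Fin p.l) :
    (comp q p h).rel x y ↔ glue q p h (outer q p x) (outer q p y) := Iff.rfl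

theorem glue_of_fst {q p : TCP} (h : q.l = p.k) {x y : Fin q.k ⊕ Fin q.l} (hxy : q.rel x y) :
    glue q p h (.inl x) (.inl y) :=
  Relation.EqvGen.rel _ _ (Or.inl ⟨x, y, hxy, rfl, rfl⟩)

theorem glue_of_snd {q p : TCP} (h : q.l = p.k) {x y : Fin p.k ⊕ Fin p.l} (hxy : p.rel x y) :
    glue q p h (compEmbMid q p h x) (compEmbMid q p h y) :=
  Relation.EqvGen.rel _ _ (Or.inr ⟨x, y, hxy, rfl, rfl⟩)

theorem glue_le_iff (q p : TCP) (h : q.l = p.k) (s : Setoid ((Fin q.k ⊕ Fin q.l) ⊕ Fin p.l)) :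
    glue q p h ≤ s ↔ (∀ x y, q.rel x y → s (.inl x) (.inl y)) ∧
      ∀ x y, p.rel x y → s (compEmbMid q p h x) (compEmbMid q p h y) := by
  constructor
  · exact fun hs => ⟨fun x y hxy => hs (glue_of_fst h hxy), fun x y hxy => hs (glue_of_snd h hxy)⟩
  · rintro ⟨h1, h2⟩
    refine Setoid.eqvGen_le ?_
    rintro _ _ (⟨x, y, hxy, rfl, rfl⟩ | ⟨x, y, hxy, rfl, rfl⟩)
    · exact h1 x y hxy
    · exact h2 x y hxy

/-- An involution on the points of the lower factor of a composition, extended by the identity. -/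
def extendSnd (q p : TCP) (h : q.l = p.k) (τ : Fin p.k ⊕ Fin p.l → Fin p.k ⊕ Fin p.l) :
    (Fin q.k ⊕ Fin q.l) ⊕ Fin p.l → (Fin q.k ⊕ Fin q.l) ⊕ Fin p.l
  | .inl (.inl i) => .inl (.inl i)
  | .inl (.inr m) => compEmbMid q p h (τ (.inl (Fin.cast h m)))
  | .inr j => compEmbMid q p h (τ (.inr j))

theorem extendSnd_compEmbMid (q p : TCP) (h : q.l = p.k) (τ) (x : Fin p.k ⊕ Fin p.l) :
    extendSnd q p h τ (compEmbMid q p h x) = compEmbMid q p h (τ x) := by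
  rcases x with x | x <;> rfl

theorem compEmbMid_injective (q p : TCP) (h : q.l = p.k) :
    Function.Injective (compEmbMid q p h) := by
  rintro (x | x) (y | y) hxy <;> simp_all [compEmbMid]

theorem eq_or_eq_compEmbMid (q p : TCP) (h : q.l = p.k) (t : (Fin q.k ⊕ Fin q.l) ⊕ Fin p.l) :
    (∃ i, t = .inl (.inl i)) ∨ ∃ x, t = compEmbMid q p h x := by
  rcases t with (i | m) | j
  · exact Or.inl ⟨i, rfl⟩
  · exact Or.inr ⟨.inl (Fin.cast h m), rfl⟩
  · exact Or.inr ⟨.inr j, rfl⟩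

theorem outer_injective (q p : TCP) : Function.Injective (outer q p) := by
  rintro (x | x) (y | y) hxy <;> simp_all [outer]

theorem IsPairing.comp {q p : TCP} (hq : IsPairing q.rel) (hp : IsPairing p.rel)
    (h : q.l = p.k) : IsPairing (comp q p h).rel := by
  obtain ⟨σ, hσ, hσne, hσr⟩ := hq.exists_involution
  obtain ⟨τ, hτ, hτne, hτr⟩ := hp.exists_involution
  have hαi : Function.Involutive (Sum.map σ id : (Fin q.k ⊕ Fin q.l) ⊕ Fin p.l → _) := by
    rintro (x | x)
    · simp [hσ x]
    · rfl
  have hβi : Function.Involutive (extendSnd q p h τ) := by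
    intro t
    rcases eq_or_eq_compEmbMid q p h t with ⟨i, rfl⟩ | ⟨x, rfl⟩
    · rfl
    · rw [extendSnd_compEmbMid, extendSnd_compEmbMid, hτ x]
  set α := hαi.toPerm with hα
  set β := hβi.toPerm with hβ
  have hα1 : ∀ x, α (.inl x) = .inl (σ x) := fun x => rfl
  have hα2 : ∀ x, α (.inr x) = .inr x := fun x => rfl
  have hβ1 : ∀ x, β (.inl (.inl x)) = .inl (.inl x) := fun x => rfl
  have hβ2 : ∀ x, β (compEmbMid q p h x) = compEmbMid q p h (τ x) :=
    extendSnd_compEmbMid q p h τ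
  have hαfix : ∀ t, α t = t ↔ ∃ j, t = .inr j := by
    rintro (x | x)
    · simp [hα1, hσne]
    · simp [hα2]
  have hβfix : ∀ t, β t = t ↔ ∃ i, t = .inl (.inl i) := by
    intro t
    rcases eq_or_eq_compEmbMid q p h t with ⟨i, rfl⟩ | ⟨x, rfl⟩
    · simp [hβ1]
    · rw [hβ2, (compEmbMid_injective q p h).eq_iff]
      rcases x with x | x <;> simp [hτne, compEmbMid]
  have hr : ∀ s, glue q p h ≤ s ↔ ∀ x, s x (α x) ∧ s x (β x) := by
    intro s
    rw [glue_le_iff]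
    constructor
    · rintro ⟨h1, h2⟩ t
      constructor
      · rcases t with x | j
        · exact h1 _ _ ((hσr x _).2 (Or.inr rfl))
        · exact s.refl _
      · rcases eq_or_eq_compEmbMid q p h t with ⟨i, rfl⟩ | ⟨x, rfl⟩
        · exact s.refl _
        · rw [hβ2]
          exact h2 _ _ ((hτr x _).2 (Or.inr rfl))
    · intro hs
      constructor
      · intro x y hxy
        rcases (hσr x y).1 hxy with rfl | rfl
        · exact s.refl _
        · exact (hs (.inl x)).1
      · intro x y hxy
        rcases (hτr x y).1 hxy with rfl | rfl
        · exact s.refl _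
        · rw [← hβ2]
          exact (hs _).2
  have hfix : ∀ t, (α t = t ∨ β t = t) ↔ ∃ z, t = outer q p z := by
    intro t
    rw [hαfix, hβfix, Sum.exists, or_comm]
    rfl
  have hboth : ∀ t, ¬ (α t = t ∧ β t = t) := by
    rintro t ⟨h1, h2⟩
    obtain ⟨j, rfl⟩ := (hαfix t).1 h1
    obtain ⟨i, hi⟩ := (hβfix _).1 h2
    cases hi
  have main : ∀ x, ∃ y, y ≠ outer q p x ∧ (α y = y ∨ β y = y) ∧ glue q p h (outer q p x) y ∧
      ∀ z, (α z = z ∨ β z = z) → glue q p h (outer q p x) z → z = outer q p x ∨ z = y := by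
    rintro (i | j)
    · exact exists_unique_other_fixed (α := α) (β := β) hαi hβi hboth ((hβfix _).2 ⟨i, rfl⟩) hr
    · obtain ⟨y, hy1, hy2, hy3, hy4⟩ := exists_unique_other_fixed (α := β) (β := α) hβi hαi
        (fun t ht => hboth t ht.symm) ((hαfix _).2 ⟨j, rfl⟩)
        (fun s => (hr s).trans (forall_congr' fun _ => and_comm))
      exact ⟨y, hy1, hy2.symm, hy3, fun z hz => hy4 z hz.symm⟩
  intro x
  obtain ⟨y, hy1, hy2, hy3, hy4⟩ := main x
  obtain ⟨y, rfl⟩ := (hfix y).1 hy2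
  refine ⟨y, fun hyx => hy1 (by rw [hyx]), fun z => ⟨fun hz => ?_, ?_⟩⟩
  · rcases hy4 _ ((hfix _).2 ⟨z, rfl⟩) hz with hz | hz
    · exact Or.inl (outer_injective q p hz)
    · exact Or.inr (outer_injective q p hz)
  · rintro (rfl | rfl)
    · exact (CTCP.comp q p h).rel.refl _
    · exact hy3

/-! ### Noncrossing pair partitions -/

/-- Noncrossing pair partitions. -/
def IsNCPair (p : TCP) : Prop := Noncrossing p ∧ IsPairing p.rel

/-- The order embedding of `Fin (n - 2)` into `Fin n` omitting `i` and `i + 1`. -/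
def skipTwo {n : ℕ} (i : ℕ) (m : Fin (n - 2)) : Fin n :=
  if m.1 < i then ⟨m.1, by omega⟩ else ⟨m.1 + 2, by omega⟩

theorem skipTwo_val {n : ℕ} (i : ℕ) (m : Fin (n - 2)) :
    (skipTwo i m).1 = if m.1 < i then m.1 else m.1 + 2 := by
  unfold skipTwo
  split_ifs <;> rfl

theorem skipTwo_strictMono {n : ℕ} (i : ℕ) : StrictMono (skipTwo (n := n) i) := by
  intro u v huv
  rw [Fin.lt_def] at huv ⊢
  rw [skipTwo_val, skipTwo_val]
  split_ifs <;> omega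

/-- Deleting two neighbouring lower points. -/
def deleteTwo (p : TCP) (i : ℕ) : TCP where
  k := p.k
  l := p.l - 2
  upColor := p.upColor
  lowColor := fun m => p.lowColor (skipTwo i m)
  rel := Setoid.comap (Sum.map id (skipTwo i)) p.rel

theorem linePos_deleteTwo_lt {p : TCP} {i : ℕ} {u v : Fin p.k ⊕ Fin (p.l - 2)}
    (huv : linePos (deleteTwo p i) u < linePos (deleteTwo p i) v) :
    linePos p (Sum.map id (skipTwo i) u) < linePos p (Sum.map id (skipTwo i) v) := by
  rcases u with u | u <;> rcases v with v | v
  · exact huv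
  · change p.k - 1 - u.1 < p.k + (skipTwo i v).1
    omega
  · change p.k + u.1 < p.k - 1 - v.1 at huv
    omega
  · change p.k + u.1 < p.k + v.1 at huv
    exact Nat.add_lt_add_left (Fin.lt_def.1 (skipTwo_strictMono i (Fin.lt_def.2 (by omega)))) _

theorem exists_adjacent_of_lt {p : TCP} (hp : IsNCPair p) (hk : p.k = 0) (d : ℕ) :
    ∀ a x : Fin p.l, a.1 < x.1 → x.1 ≤ a.1 + d → p.rel (.inr a) (.inr x) →
      ∃ (i : ℕ) (hi : i + 1 < p.l), p.rel (.inr ⟨i, by omega⟩) (.inr ⟨i + 1, hi⟩) := by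
  induction d with
  | zero => intro a x h1 h2; omega
  | succ d ih =>
    intro a x hax hd hr
    by_cases hx : x.1 = a.1 + 1
    · refine ⟨a.1, by omega, ?_⟩
      convert hr
      exact hx.symm
    let b : Fin p.l := ⟨a.1 + 1, by omega⟩
    have hcl : ∀ {u v w : Fin p.k ⊕ Fin p.l}, p.rel u v → p.rel u w → u ≠ v → u ≠ w → v = w := by
      intro u v w huv huw h1 h2
      obtain ⟨c, -, hc⟩ := hp.2 u
      rw [((hc v).1 huv).resolve_left h1.symm, ((hc w).1 huw).resolve_left h2.symm]
    have hne : ∀ {u v : Fin p.l}, u.1 ≠ v.1 → (.inr u : Fin p.k ⊕ Fin p.l) ≠ .inr v := by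
      intro u v h h'
      exact h (congrArg Fin.val (Sum.inr.inj h'))
    obtain ⟨y, hyb, hy⟩ := hp.2 (.inr b)
    have hby : p.rel (.inr b) y := (hy y).2 (Or.inr rfl)
    rcases y with y | y
    · have := y.2; omega
    have hyb' : y.1 ≠ a.1 + 1 := fun h => hyb (by congr 1; exact Fin.ext h)
    have hnot : ¬ p.rel (.inr a) (.inr b) := by
      intro h
      have := hcl h hr (hne (by simp [b])) (hne (by omega))
      exact hne (by simp only [b]; omega) this
    have hlp : ∀ j : Fin p.l, linePos p (.inr j) = j.1 := by
      intro j
      simp [linePos, hk]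
    rcases lt_trichotomy y.1 a.1 with h1 | h1 | h1
    · exfalso
      have h2 : p.rel (.inr y) (.inr a) := by
        refine hp.1 (.inr y) (.inr a) (.inr b) (.inr x) ?_ ?_ ?_ (p.rel.symm hby) hr
        all_goals simp only [hlp, b]; omega
      exact hnot (p.rel.trans (p.rel.symm h2) (p.rel.symm hby))
    · refine absurd (p.rel.symm hby) ?_
      rwa [show y = a from Fin.ext h1]
    · by_cases h2 : y.1 < x.1
      · exact ih b y (by simp only [b]; omega) (by simp only [b]; omega) hby
      · exfalso
        rcases eq_or_lt_of_le (not_lt.1 h2) with h3 | h3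
        · rw [← show x = y from Fin.ext h3] at hby
          exact hnot (p.rel.trans hr (p.rel.symm hby))
        · refine hnot (hp.1 (.inr a) (.inr b) (.inr x) (.inr y) ?_ ?_ ?_ hr hby)
          all_goals simp only [hlp, b]; omega

theorem IsNCPair.exists_adjacent {p : TCP} (hp : IsNCPair p) (hk : p.k = 0) (hl : p.l ≠ 0) :
    ∃ (i : ℕ) (hi : i + 1 < p.l), p.rel (.inr ⟨i, by omega⟩) (.inr ⟨i + 1, hi⟩) := by
  obtain ⟨y, hy0, hy⟩ := hp.2 (.inr ⟨0, by omega⟩)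
  have hr := (hy y).2 (Or.inr rfl)
  rcases y with y | y
  · have := y.2; omega
  have hy1 : y.1 ≠ 0 := fun h => hy0 (by congr 1; exact Fin.ext h)
  exact exists_adjacent_of_lt hp hk y.1 _ y (by simp only; omega) (by simp) hr

theorem IsNCPair.deleteTwo {p : TCP} (hp : IsNCPair p) {i : ℕ} (hi : i + 1 < p.l)
    (hr : p.rel (.inr ⟨i, by omega⟩) (.inr ⟨i + 1, hi⟩)) : IsNCPair (deleteTwo p i) := by
  constructor
  · intro a b x y hab hbx hxy h1 h2
    exact hp.1 _ _ _ _ (linePos_deleteTwo_lt hab) (linePos_deleteTwo_lt hbx) (linePos_deleteTwo_lt hxy)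
      h1 h2
  · refine hp.2.comap ?_ ?_
    · refine Function.Injective.sumMap Function.injective_id (skipTwo_strictMono i).injective
    · intro a b hab
      rcases b with b | b
      · exact ⟨.inl b, rfl⟩
      have key : b.1 ≠ i ∧ b.1 ≠ i + 1 := by
        by_contra hcon
        have hb : p.rel (.inr b) (.inr ⟨i, by omega⟩) ∧ p.rel (.inr b) (.inr ⟨i + 1, hi⟩) := by
          rcases (by omega : b.1 = i ∨ b.1 = i + 1) with h | h
          · rw [show b = ⟨i, by omega⟩ from Fin.ext h]
            exact ⟨p.rel.refl _, hr⟩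
          · rw [show b = ⟨i + 1, by omega⟩ from Fin.ext h]
            exact ⟨p.rel.symm hr, p.rel.refl _⟩
        obtain ⟨c, -, hc⟩ := hp.2 (Sum.map id (skipTwo i) a)
        have h1 := (hc _).1 (p.rel.trans hab hb.1)
        have h2 := (hc _).1 (p.rel.trans hab hb.2)
        have hne : (.inr ⟨i, by omega⟩ : Fin p.k ⊕ Fin p.l) ≠ .inr ⟨i + 1, hi⟩ := by simp
        have hnot : ∀ (j : ℕ) (hj : j < p.l), j = i ∨ j = i + 1 →
            (.inr ⟨j, hj⟩ : Fin p.k ⊕ Fin p.l) ≠ Sum.map id (skipTwo i) a := by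
          intro j hj hji h
          rcases a with a | a
          · exact Sum.inr_ne_inl h
          · have h3 : j = (skipTwo (n := p.l) i a).1 := congrArg Fin.val (Sum.inr.inj h)
            have h4 := skipTwo_val (n := p.l) i a
            split_ifs at h4 <;> omega
        have h1' := h1.resolve_left (hnot _ _ (Or.inl rfl))
        have h2' := h2.resolve_left (hnot _ _ (Or.inr rfl))
        exact hne (h1'.trans h2'.symm)
      refine ⟨.inr ⟨if b.1 < i then b.1 else b.1 - 2, ?_⟩, ?_⟩
      · have := b.2
        simp only [CTCP.deleteTwo]
        split_ifs <;> omega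
      · refine congrArg Sum.inr (Fin.ext ?_)
        refine (skipTwo_val (n := p.l) i _).trans ?_
        dsimp only
        split_ifs <;> omega

/-- The inclusion of the points of a rotated partition. -/
def rotPt (p : TCP) (h : 0 < p.k) : Fin (p.k - 1) ⊕ Fin (p.l + 1) → Fin p.k ⊕ Fin p.l :=
  Sum.elim (fun i => .inl ⟨i.1 + 1, by omega⟩)
    (fun j => if hj : j.1 = 0 then .inl ⟨0, h⟩ else .inr ⟨j.1 - 1, by omega⟩)

theorem linePos_rotULdown (p : TCP) (h : 0 < p.k) (x : Fin (p.k - 1) ⊕ Fin (p.l + 1)) :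
    linePos (rotULdown p h) x = linePos p (rotPt p h x) := by
  rcases x with x | x
  · change p.k - 1 - 1 - x.1 = p.k - 1 - (x.1 + 1)
    omega
  · by_cases hx : x.1 = 0
    · have h1 : rotPt p h (.inr x) = .inl ⟨0, h⟩ := dif_pos hx
      rw [h1]
      change p.k - 1 + x.1 = p.k - 1 - 0
      omega
    · have h1 : rotPt p h (.inr x) = .inr ⟨x.1 - 1, by omega⟩ :=
        dif_neg hx
      rw [h1]
      change p.k - 1 + x.1 = p.k + (x.1 - 1)
      omega

theorem linePos_injective (p : TCP) : Function.Injective (linePos p) := by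
  rintro (x | x) (y | y) hxy <;> simp only [linePos, Sum.elim_inl, Sum.elim_inr] at hxy
  · congr 1
    exact Fin.ext (by omega)
  · omega
  · omega
  · congr 1
    exact Fin.ext (by omega)

theorem IsNCPair.rotULdown {p : TCP} (hp : IsNCPair p) (h : 0 < p.k) :
    IsNCPair (rotULdown p h) := by
  constructor
  · intro a b x y hab hbx hxy h1 h2
    have hlt : ∀ {u v : Fin (p.k - 1) ⊕ Fin (p.l + 1)},
        linePos (CTCP.rotULdown p h) u < linePos (CTCP.rotULdown p h) v →
        linePos p (rotPt p h u) < linePos p (rotPt p h v) := by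
      intro u v huv
      rwa [linePos_rotULdown, linePos_rotULdown] at huv
    exact hp.1 _ _ _ _ (hlt hab) (hlt hbx) (hlt hxy) h1 h2
  · refine hp.2.comap (e := rotPt p h) ?_ ?_
    · intro x y hxy
      apply linePos_injective (CTCP.rotULdown p h)
      exact (linePos_rotULdown p h x).trans
        ((congrArg _ hxy).trans (linePos_rotULdown p h y).symm)
    · rintro a (b | b) -
      · by_cases hb : b.1 = 0
        · exact ⟨.inr ⟨0, by omega⟩, congrArg Sum.inl (Fin.ext hb.symm)⟩
        · exact ⟨.inl ⟨b.1 - 1, by omega⟩, congrArg Sum.inl (Fin.ext (Nat.sub_add_cancel (by omega)))⟩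
      · exact ⟨.inr ⟨b.1 + 1, by omega⟩, by simp [rotPt]⟩

theorem IsNCPair.induction_line {P : TCP → Prop} (hempty : ∀ p, p.k = 0 → p.l = 0 → P p)
    (hdel : ∀ p (i : ℕ) (hi : i + 1 < p.l), IsNCPair p → p.k = 0 →
      p.rel (.inr ⟨i, by omega⟩) (.inr ⟨i + 1, hi⟩) → P (CTCP.deleteTwo p i) → P p)
    {p : TCP} (hp : IsNCPair p) (hk : p.k = 0) : P p := by
  induction hn : p.l using Nat.strong_induction_on generalizing p with
  | _ n ih =>
    by_cases hl : p.l = 0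
    · exact hempty p hk hl
    · obtain ⟨i, hi, hr⟩ := hp.exists_adjacent hk hl
      refine hdel p i hi hp hk hr (ih (p.l - 2) (by omega) (hp.deleteTwo hi hr) hk rfl)

theorem IsNCPair.induction_rot {P : TCP → Prop} (hline : ∀ p, IsNCPair p → p.k = 0 → P p)
    (hrot : ∀ p (h : 0 < p.k), IsNCPair p → P (CTCP.rotULdown p h) → P p)
    {p : TCP} (hp : IsNCPair p) : P p := by
  induction hn : p.k generalizing p with
  | zero => exact hline p hp hn
  | succ n ih =>
    have h : 0 < p.k := by omega
    exact hrot p h hp (ih (hp.rotULdown h) (by simp [CTCP.rotULdown, hn]))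

/-! ### A group-theoretic criterion -/

theorem ofFn_eq_cons {G : Type*} {n : ℕ} (h : 0 < n) (g : Fin n → G) :
    List.ofFn g = g ⟨0, h⟩ :: List.ofFn (fun i : Fin (n - 1) => g ⟨i.1 + 1, by omega⟩) := by
  cases n with
  | zero => omega
  | succ n => exact List.ofFn_succ

theorem prod_ofFn_skipTwo {G : Type*} [Group G] {n : ℕ} (i : ℕ) (hi : i + 1 < n) (g : Fin n → G)
    (hg : g ⟨i, by omega⟩ * g ⟨i + 1, hi⟩ = 1) :
    (List.ofFn fun m => g (skipTwo i m)).prod = (List.ofFn g).prod := by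
  induction i generalizing n with
  | zero =>
    rw [ofFn_eq_cons (by omega : 0 < n), ofFn_eq_cons (by omega : 0 < n - 1), List.prod_cons,
      List.prod_cons, ← mul_assoc, hg, one_mul]
    rfl
  | succ i ih =>
    rw [ofFn_eq_cons (by omega : 0 < n), ofFn_eq_cons (by omega : 0 < n - 2), List.prod_cons,
      List.prod_cons, ← ih (n := n - 1) (by omega) (fun m => g ⟨m.1 + 1, by omega⟩) hg]
    have h0 : skipTwo i.succ ⟨0, by omega⟩ = (⟨0, by omega⟩ : Fin n) := rfl
    rw [h0]
    congr 2
    · have e : n - 2 - 1 = n - 1 - 2 := by omega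
      rw [List.ofFn_congr e]
      congr 1
      funext m
      congr 1
      refine Fin.ext ?_
      simp only [skipTwo_val, Fin.val_cast]
      split_ifs <;> omega

/-- Labelling the blocks by involutions of the symmetric group on three letters, the product
along the upper row agrees with the product along the lower row. -/
def WordEq (p : TCP) : Prop :=
  ∀ f : Fin p.k ⊕ Fin p.l → Equiv.Perm (Fin 3), (∀ x y, p.rel x y → f x = f y) →
    (∀ x, f x * f x = 1) →
    (List.ofFn fun i => f (.inl i)).prod = (List.ofFn fun j => f (.inr j)).prod

theorem IsNCPair.wordEq {p : TCP} (hp : IsNCPair p) : WordEq p := by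
  refine hp.induction_rot (fun p hp hk => hp.induction_line ?_ ?_ hk) ?_
  · intro p hk hl f _ _
    rw [List.ofFn_congr hk, List.ofFn_congr hl]
    simp
  · intro p i hi _ hk hr ih f hf hsq
    have h1 := ih (fun x => f (Sum.map id (skipTwo i) x)) (fun x y hxy => hf _ _ hxy)
      (fun x => hsq _)
    refine h1.trans (prod_ofFn_skipTwo i hi (fun j => f (.inr j)) ?_)
    rw [hf _ _ hr, hsq]
  · intro p h _ ih f hf hsq
    have h1 := ih (fun x => f (rotPt p h x)) (fun x y hxy => hf _ _ hxy) (fun x => hsq _)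
    have h2 : (List.ofFn fun j : Fin (p.l + 1) => f (rotPt p h (.inr j))) =
        f (.inl ⟨0, h⟩) :: List.ofFn fun j => f (.inr j) := List.ofFn_succ
    rw [ofFn_eq_cons h, List.prod_cons]
    change (List.ofFn fun i : Fin (p.k - 1) => f (rotPt p h (.inl i))).prod =
      (List.ofFn fun j : Fin (p.l + 1) => f (rotPt p h (.inr j))).prod at h1
    rw [h2, List.prod_cons] at h1
    change _ * (List.ofFn fun i : Fin (p.k - 1) => f (rotPt p h (.inl i))).prod = _
    rw [h1, ← mul_assoc, hsq, one_mul]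

section Words

variable {G : Type*} [Group G]

theorem prod_range_eq_of_one {h : ℕ → G} {m n : ℕ} (hmn : m ≤ n)
    (hh : ∀ j, m ≤ j → j < n → h j = 1) :
    ((List.range n).map h).prod = ((List.range m).map h).prod := by
  induction n, hmn using Nat.le_induction with
  | base => rfl
  | succ n hmn ih =>
    rw [List.prod_range_succ, hh n hmn (by omega), mul_one,
      ih fun j h1 h2 => hh j h1 (by omega)]

theorem prod_range_four {h : ℕ → G} {n a b x y : ℕ} (hab : a < b) (hbx : b < x) (hxy : x < y)
    (hyn : y < n) (hh : ∀ j, j < n → j ≠ a → j ≠ b → j ≠ x → j ≠ y → h j = 1) :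
    ((List.range n).map h).prod = h a * h b * h x * h y := by
  rw [prod_range_eq_of_one (m := y + 1) (by omega) fun j _ _ =>
      hh j (by omega) (by omega) (by omega) (by omega) (by omega), List.prod_range_succ,
    prod_range_eq_of_one (m := x + 1) (by omega) fun j _ _ =>
      hh j (by omega) (by omega) (by omega) (by omega) (by omega), List.prod_range_succ,
    prod_range_eq_of_one (m := b + 1) (by omega) fun j _ _ =>
      hh j (by omega) (by omega) (by omega) (by omega) (by omega), List.prod_range_succ,
    prod_range_eq_of_one (m := a + 1) (by omega) fun j _ _ =>
      hh j (by omega) (by omega) (by omega) (by omega) (by omega), List.prod_range_succ,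
    prod_range_eq_of_one (m := 0) (by omega) fun j _ _ =>
      hh j (by omega) (by omega) (by omega) (by omega) (by omega)]
  simp

theorem prod_range_reverse_mul {g : ℕ → G} (hg : ∀ j, g j * g j = 1) (n : ℕ) :
    ((List.range n).map fun j => g (n - 1 - j)).prod * ((List.range n).map g).prod = 1 := by
  induction n with
  | zero => simp
  | succ n ih =>
    rw [List.prod_range_succ', List.prod_range_succ]
    have h1 : (fun j => g (n + 1 - 1 - (j + 1))) = fun j => g (n - 1 - j) := by
      funext j
      congr 1
      omega
    simp only [Nat.succ_eq_add_one, h1]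
    calc _ = g n * (((List.range n).map fun j => g (n - 1 - j)).prod *
          ((List.range n).map g).prod) * g n := by simp [mul_assoc]
      _ = 1 := by rw [ih, mul_one, hg]

theorem prod_ofFn_eq_prod_range {n : ℕ} (g : Fin n → G) :
    (List.ofFn g).prod =
      ((List.range n).map fun j => if hj : j < n then g ⟨j, hj⟩ else 1).prod := by
  rw [List.ofFn_eq_map, ← List.map_coe_finRange_eq_range, List.map_map]
  congr 1
  refine List.map_congr_left fun j _ => ?_
  simp

end Words

theorem WordEq.noncrossing {p : TCP} (hw : WordEq p) (hp : IsPairing p.rel) : Noncrossing p := by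
  classical
  intro a b x y hab hbx hxy hax hby
  by_contra hnot
  let s : Equiv.Perm (Fin 3) := Equiv.swap 0 1
  let t : Equiv.Perm (Fin 3) := Equiv.swap 1 2
  let f : Fin p.k ⊕ Fin p.l → Equiv.Perm (Fin 3) := fun z =>
    if p.rel a z then s else if p.rel b z then t else 1
  have hf : ∀ u v, p.rel u v → f u = f v := by
    intro u v huv
    have h1 : ∀ c, p.rel c u ↔ p.rel c v := fun c =>
      ⟨fun h => p.rel.trans h huv, fun h => p.rel.trans h (p.rel.symm huv)⟩
    simp only [f, h1]
  have hss : s * s = 1 := by decide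
  have htt : t * t = 1 := by decide
  have hsq : ∀ u, f u * f u = 1 := by
    intro u
    simp only [f]
    split_ifs
    · exact hss
    · exact htt
    · exact mul_one 1
  have heq := hw f hf hsq
  rw [prod_ofFn_eq_prod_range, prod_ofFn_eq_prod_range] at heq
  set up : ℕ → Equiv.Perm (Fin 3) := fun j => if hj : j < p.k then f (.inl ⟨j, hj⟩) else 1 with hup
  set low : ℕ → Equiv.Perm (Fin 3) := fun j => if hj : j < p.l then f (.inr ⟨j, hj⟩) else 1
    with hlow
  let h : ℕ → Equiv.Perm (Fin 3) := fun j => if j < p.k then up (p.k - 1 - j) else low (j - p.k)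
  have hline : ((List.range (p.k + p.l)).map h).prod = 1 := by
    have hsq' : ∀ j, up j * up j = 1 := by
      intro j
      simp only [hup]
      split_ifs
      · exact hsq _
      · exact mul_one 1
    rw [List.range_add, List.map_append, List.prod_append, List.map_map,
      ← prod_range_reverse_mul hsq' p.k, heq]
    congr 2
    · refine List.map_congr_left fun j hj => ?_
      simp [h, List.mem_range.1 hj]
    · refine List.map_congr_left fun j hj => ?_
      simp [h]
  have hpos : ∀ z, h (linePos p z) = f z := by
    rintro (z | z)
    · have h1 : p.k - 1 - z.1 < p.k := by omega
      have h2 : p.k - 1 - (p.k - 1 - z.1) = z.1 := by omega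
      simp [h, linePos, h1, h2, hup]
    · simp [h, linePos, hlow]
  have hsurj : ∀ j, j < p.k + p.l → ∃ z, linePos p z = j := by
    intro j hj
    by_cases hjk : j < p.k
    · exact ⟨.inl ⟨p.k - 1 - j, by omega⟩, by simp [linePos]; omega⟩
    · exact ⟨.inr ⟨j - p.k, by omega⟩, by simp [linePos]; omega⟩
  have hlt : linePos p y < p.k + p.l := by
    rcases y with y | y <;> simp only [linePos, Sum.elim_inl, Sum.elim_inr] <;> omega
  rw [prod_range_four hab hbx hxy hlt] at hline
  · have ha : f a = s := if_pos (p.rel.refl a)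
    have hb : f b = t := by
      simp only [f]
      rw [if_neg hnot, if_pos (p.rel.refl b)]
    rw [hpos, hpos, hpos, hpos, ← hf a x hax, ← hf b y hby, ha, hb] at hline
    exact absurd hline (by decide)
  · intro j hj h1 h2 h3 h4
    obtain ⟨z, rfl⟩ := hsurj j hj
    have hcl : ∀ {u v w : Fin p.k ⊕ Fin p.l}, p.rel u v → u ≠ v → p.rel u w → w = u ∨ w = v := by
      intro u v w huv h1 huw
      obtain ⟨c, -, hc⟩ := hp u
      rw [((hc v).1 huv).resolve_left h1.symm]
      exact (hc w).1 huw
    have hza : ¬ p.rel a z := by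
      intro haz
      rcases hcl hax (fun e => by rw [e] at hab; omega) haz with rfl | rfl
      · exact h1 rfl
      · exact h3 rfl
    have hzb : ¬ p.rel b z := by
      intro haz
      rcases hcl hby (fun e => by rw [e] at hbx; omega) haz with rfl | rfl
      · exact h2 rfl
      · exact h4 rfl
    rw [hpos]
    simp only [f]
    rw [if_neg hza, if_neg hzb]

/-! ### Closure of noncrossing pair partitions under the category operations -/

/-- The inclusion of the points of the left factor of a tensor product. -/
def tensorLeft (p q : TCP) : Fin p.k ⊕ Fin p.l → Fin (p.k + q.k) ⊕ Fin (p.l + q.l) :=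
  Sum.map (Fin.castAdd q.k) (Fin.castAdd q.l)

/-- The inclusion of the points of the right factor of a tensor product. -/
def tensorRight (p q : TCP) : Fin q.k ⊕ Fin q.l → Fin (p.k + q.k) ⊕ Fin (p.l + q.l) :=
  Sum.map (Fin.natAdd p.k) (Fin.natAdd p.l)

theorem splitPt_tensorLeft (p q : TCP) (x) : splitPt p q (tensorLeft p q x) = .inl x := by
  rcases x with x | x <;> simp [splitPt, tensorLeft]

theorem splitPt_tensorRight (p q : TCP) (x) : splitPt p q (tensorRight p q x) = .inr x := by
  rcases x with x | x <;> simp [splitPt, tensorRight]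

theorem tensor_rel_left {p q : TCP} {x y : Fin p.k ⊕ Fin p.l} (hxy : p.rel x y) :
    (tensor p q).rel (tensorLeft p q x) (tensorLeft p q y) := by
  change sumSetoid p.rel q.rel (splitPt p q _) (splitPt p q _)
  rw [splitPt_tensorLeft, splitPt_tensorLeft]
  exact hxy

theorem tensor_rel_right {p q : TCP} {x y : Fin q.k ⊕ Fin q.l} (hxy : q.rel x y) :
    (tensor p q).rel (tensorRight p q x) (tensorRight p q y) := by
  change sumSetoid p.rel q.rel (splitPt p q _) (splitPt p q _)
  rw [splitPt_tensorRight, splitPt_tensorRight]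
  exact hxy

theorem WordEq.tensor {p q : TCP} (hp : WordEq p) (hq : WordEq q) : WordEq (tensor p q) := by
  intro f hf hsq
  have h1 := hp (fun x => f (tensorLeft p q x)) (fun x y hxy => hf _ _ (tensor_rel_left hxy))
    fun x => hsq _
  have h2 := hq (fun x => f (tensorRight p q x)) (fun x y hxy => hf _ _ (tensor_rel_right hxy))
    fun x => hsq _
  change (List.ofFn fun i : Fin (p.k + q.k) => f (.inl i)).prod =
    (List.ofFn fun i : Fin (p.l + q.l) => f (.inr i)).prod
  rw [List.ofFn_add, List.ofFn_add, List.prod_append, List.prod_append]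
  exact congrArg₂ (· * ·) h1 h2

theorem WordEq.invol {p : TCP} (hp : WordEq p) : WordEq (invol p) := by
  intro f hf hsq
  refine (hp (fun x => f x.swap) (fun x y hxy => hf _ _ ?_) fun x => hsq _).symm
  change p.rel x.swap.swap y.swap.swap
  rwa [Sum.swap_swap, Sum.swap_swap]

theorem WordEq.comp {q p : TCP} (hq : WordEq q) (hp : WordEq p) (h : q.l = p.k) :
    WordEq (comp q p h) := by
  classical
  intro f hf hsq
  let g : (Fin q.k ⊕ Fin q.l) ⊕ Fin p.l → Equiv.Perm (Fin 3) := fun t =>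
    if ht : ∃ z, glue q p h t (outer q p z) then f ht.choose else 1
  have hg : ∀ t t', glue q p h t t' → g t = g t' := by
    intro t t' htt
    by_cases ht : ∃ z, glue q p h t (outer q p z)
    · have ht' : ∃ z, glue q p h t' (outer q p z) :=
        ht.imp fun z hz => Setoid.trans' _ (Setoid.symm' _ htt) hz
      simp only [g, dif_pos ht, dif_pos ht']
      refine hf _ _ ((comp_rel q p h _ _).2 ?_)
      exact Setoid.trans' _ (Setoid.symm' _ ht.choose_spec)
        (Setoid.trans' _ htt ht'.choose_spec)
    · have ht' : ¬ ∃ z, glue q p h t' (outer q p z) := fun ht' =>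
        ht (ht'.imp fun z hz => Setoid.trans' _ htt hz)
      simp only [g, dif_neg ht, dif_neg ht']
  have hgo : ∀ z, g (outer q p z) = f z := by
    intro z
    have hz : ∃ z', glue q p h (outer q p z) (outer q p z') := ⟨z, Setoid.refl' _ _⟩
    simp only [g, dif_pos hz]
    exact hf _ _ (Setoid.symm' _ hz.choose_spec)
  have hgsq : ∀ t, g t * g t = 1 := by
    intro t
    simp only [g]
    split_ifs
    · exact hsq _
    · exact mul_one 1
  have h1 := hq (fun x => g (.inl x)) (fun x y hxy => hg _ _ (glue_of_fst h hxy)) fun x => hgsq _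
  have h2 := hp (fun x => g (compEmbMid q p h x)) (fun x y hxy => hg _ _ (glue_of_snd h hxy))
    fun x => hgsq _
  have h3 : (List.ofFn fun i => g (.inl (.inr i))) =
      List.ofFn fun i => g (compEmbMid q p h (.inl i)) := List.ofFn_congr h _
  rw [h3] at h1
  have h4 := h1.trans h2
  have h5 : (fun i => g (.inl (.inl i))) = fun i => f (.inl i) := funext fun i => hgo (.inl i)
  have h6 : (fun j => g (compEmbMid q p h (.inr j))) = fun j => f (.inr j) :=
    funext fun j => hgo (.inr j)
  rw [h5, h6] at h4
  exact h4

theorem IsNCPair.tensor {p q : TCP} (hp : IsNCPair p) (hq : IsNCPair q) : IsNCPair (tensor p q) :=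
  ⟨(hp.wordEq.tensor hq.wordEq).noncrossing (hp.2.tensor hq.2), hp.2.tensor hq.2⟩

theorem IsNCPair.comp {q p : TCP} (hq : IsNCPair q) (hp : IsNCPair p) (h : q.l = p.k) :
    IsNCPair (comp q p h) :=
  ⟨(hq.wordEq.comp hp.wordEq h).noncrossing (hq.2.comp hp.2 h), hq.2.comp hp.2 h⟩

theorem IsNCPair.invol {p : TCP} (hp : IsNCPair p) : IsNCPair (invol p) :=
  ⟨hp.wordEq.invol.noncrossing hp.2.invol, hp.2.invol⟩

theorem isPairing_idPart (c : Color) : IsPairing (idPart c).rel := by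
  rintro (x | x)
  · refine ⟨.inr x, Sum.inr_ne_inl, fun z => ⟨fun _ => ?_, fun _ => trivial⟩⟩
    rcases z with z | z
    · exact Or.inl (congrArg _ (Subsingleton.elim (α := Fin 1) _ _))
    · exact Or.inr (congrArg _ (Subsingleton.elim (α := Fin 1) _ _))
  · refine ⟨.inl x, Sum.inl_ne_inr, fun z => ⟨fun _ => ?_, fun _ => trivial⟩⟩
    rcases z with z | z
    · exact Or.inr (congrArg _ (Subsingleton.elim (α := Fin 1) _ _))
    · exact Or.inl (congrArg _ (Subsingleton.elim (α := Fin 1) _ _))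

theorem isNCPair_idPart (c : Color) : IsNCPair (idPart c) := by
  refine ⟨WordEq.noncrossing ?_ (isPairing_idPart c), isPairing_idPart c⟩
  intro f hf _
  have h : f (.inl (0 : Fin 1)) = f (.inr (0 : Fin 1)) := hf _ _ trivial
  change (List.ofFn fun i : Fin 1 => f (.inl i)).prod = (List.ofFn fun i : Fin 1 => f (.inr i)).prod
  simpa using h

theorem pairLower_rel (c₁ c₂ : Color) (x y : Fin 2) :
    (pairLower c₁ c₂).rel (.inr x) (.inr y) := rfl

theorem isPairing_pairLower (c₁ c₂ : Color) : IsPairing (pairLower c₁ c₂).rel := by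
  rintro (x | (x : Fin 2))
  · exact x.elim0
  · refine ⟨.inr x.rev, fun hx => ?_, ?_⟩
    · have h : ∀ x : Fin 2, x.rev ≠ x := by decide
      exact h x (Sum.inr.inj hx)
    · rintro (z | (z : Fin 2))
      · exact z.elim0
      · refine ⟨fun _ => ?_, fun _ => pairLower_rel c₁ c₂ x z⟩
        have h : ∀ x z : Fin 2, z = x ∨ z = x.rev := by decide
        exact (h x z).imp (congrArg Sum.inr) (congrArg Sum.inr)

theorem isNCPair_pairLower (c₁ c₂ : Color) : IsNCPair (pairLower c₁ c₂) := by
  refine ⟨WordEq.noncrossing ?_ (isPairing_pairLower c₁ c₂), isPairing_pairLower c₁ c₂⟩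
  intro f hf hsq
  have h : f (.inr (0 : Fin 2)) = f (.inr (1 : Fin 2)) := hf _ _ (pairLower_rel c₁ c₂ 0 1)
  have h' := hsq (.inr (1 : Fin 2))
  change (List.ofFn fun i : Fin 0 => f (.inl i)).prod = (List.ofFn fun i : Fin 2 => f (.inr i)).prod
  simpa [List.ofFn_succ, h] using h'.symm

theorem isNCPair_of_no_points {p : TCP} (hk : p.k = 0) (hl : p.l = 0) : IsNCPair p := by
  have h : ∀ x : Fin p.k ⊕ Fin p.l, False := by
    rintro (x | x)
    · have := x.2
      omega
    · have := x.2
      omega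
  exact ⟨fun a => (h a).elim, fun a => (h a).elim⟩

theorem isNCPair_tensorPow {p : TCP} (hp : IsNCPair p) (n : ℕ) : IsNCPair (tensorPow p n) := by
  induction n with
  | zero => exact isNCPair_of_no_points rfl rfl
  | succ n ih => exact ih.tensor hp

/-! ### The color sum -/

/-- The contribution of a lower point to the color sum. -/
def colorSign (c : Color) : ℤ := if c = white then 1 else -1

theorem sum_colorSign {n : ℕ} (f : Fin n → Color) :
    ∑ i, colorSign (f i) =
      (Nat.card {i // f i = white} : ℤ) - (Nat.card {i // f i = black} : ℤ) := by
  have h : ∀ c, colorSign c = (if c = white then 1 else 0) - (if c = black then 1 else 0) := by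
    decide
  simp only [h, Finset.sum_sub_distrib, Finset.sum_boole, Nat.card_eq_fintype_card,
    Fintype.card_subtype]

theorem cval_eq_sum (p : TCP) :
    cval p = ∑ j, colorSign (p.lowColor j) - ∑ i, colorSign (p.upColor i) := by
  rw [sum_colorSign, sum_colorSign, cval]
  push_cast
  ring

theorem tensor_upColor_left (p q : TCP) (i : Fin p.k) :
    (tensor p q).upColor (Fin.castAdd q.k i) = p.upColor i := by simp [tensor]

theorem tensor_upColor_right (p q : TCP) (i : Fin q.k) :
    (tensor p q).upColor (Fin.natAdd p.k i) = q.upColor i := by simp [tensor]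

theorem tensor_lowColor_left (p q : TCP) (i : Fin p.l) :
    (tensor p q).lowColor (Fin.castAdd q.l i) = p.lowColor i := by simp [tensor]

theorem tensor_lowColor_right (p q : TCP) (i : Fin q.l) :
    (tensor p q).lowColor (Fin.natAdd p.l i) = q.lowColor i := by simp [tensor]

theorem cval_tensor (p q : TCP) : cval (tensor p q) = cval p + cval q := by
  rw [cval_eq_sum, cval_eq_sum, cval_eq_sum]
  have h1 : ∑ j, colorSign ((tensor p q).lowColor j) = _ :=
    Fin.sum_univ_add (a := p.l) (b := q.l) fun j => colorSign ((tensor p q).lowColor j)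
  have h2 : ∑ j, colorSign ((tensor p q).upColor j) = _ :=
    Fin.sum_univ_add (a := p.k) (b := q.k) fun j => colorSign ((tensor p q).upColor j)
  rw [h1, h2]
  simp only [tensor_upColor_left, tensor_upColor_right, tensor_lowColor_left,
    tensor_lowColor_right]
  ring

theorem cval_comp (q p : TCP) (h : q.l = p.k) (hc : ColorsMatch q p h) :
    cval (comp q p h) = cval q + cval p := by
  rw [cval_eq_sum, cval_eq_sum, cval_eq_sum]
  have h1 : ∑ j, colorSign (q.lowColor j) = ∑ j, colorSign (p.upColor j) :=
    Fintype.sum_equiv (finCongr h) _ _ fun j => congrArg colorSign (hc j)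
  rw [h1]
  change ∑ j, colorSign (p.lowColor j) - ∑ j, colorSign (q.upColor j) = _
  ring

theorem cval_invol (p : TCP) : cval (invol p) = -cval p := by
  rw [cval_eq_sum, cval_eq_sum, neg_sub]
  rfl

theorem cval_idPart (c : Color) : cval (idPart c) = 0 := by
  rw [cval_eq_sum]
  exact sub_self _

theorem cval_pairLower (c₁ c₂ : Color) :
    cval (pairLower c₁ c₂) = colorSign c₁ + colorSign c₂ := by
  rw [cval_eq_sum]
  change ∑ j : Fin 2, colorSign (![c₁, c₂] j) - ∑ i : Fin 0, _ = _
  simp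

theorem cval_tensorPow (p : TCP) (n : ℕ) : cval (tensorPow p n) = n * cval p := by
  induction n with
  | zero =>
    rw [cval_eq_sum]
    change ∑ j : Fin 0, _ - ∑ i : Fin 0, _ = _
    simp
  | succ n ih =>
    rw [tensorPow, cval_tensor, ih]
    push_cast
    ring

theorem cval_wwbb : cval wwbb = 0 := by
  rw [wwbb, cval_tensor, cval_pairLower, cval_pairLower]
  rfl

theorem cval_tensorPow_pairLower {k : ℕ} (hk : Even k) :
    cval (tensorPow (pairLower white white) (k / 2)) = k := by
  obtain ⟨m, rfl⟩ := hk
  rw [cval_tensorPow, cval_pairLower, show (m + m) / 2 = m by omega]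
  change (m : ℤ) * (1 + 1) = _
  push_cast
  ring

theorem isCategory_isNCPair (k : ℤ) : IsCategory {p | IsNCPair p ∧ k ∣ cval p} where
  tensor_mem p hp q hq := ⟨hp.1.tensor hq.1, by rw [cval_tensor]; exact dvd_add hp.2 hq.2⟩
  comp_mem q hq p hp h hc := ⟨hq.1.comp hp.1 h, by rw [cval_comp q p h hc]; exact dvd_add hq.2 hp.2⟩
  invol_mem p hp := ⟨hp.1.invol, by rw [cval_invol]; exact hp.2.neg_right⟩
  idw_mem := ⟨isNCPair_idPart _, by rw [cval_idPart]; exact dvd_zero _⟩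
  idb_mem := ⟨isNCPair_idPart _, by rw [cval_idPart]; exact dvd_zero _⟩
  pairwb_mem := ⟨isNCPair_pairLower _ _, by rw [cval_pairLower]; exact dvd_zero _⟩
  pairbw_mem := ⟨isNCPair_pairLower _ _, by rw [cval_pairLower]; exact dvd_zero _⟩

theorem generated_subset {k : ℕ} (hk : Even k) :
    generated {tensorPow (pairLower white white) (k / 2), wwbb} ⊆
      {p | IsNCPair p ∧ (k : ℤ) ∣ cval p} := by
  intro p hp
  refine hp _ (isCategory_isNCPair k) ?_
  rintro q (rfl | rfl)
  · exact ⟨isNCPair_tensorPow (isNCPair_pairLower _ _) _, by rw [cval_tensorPow_pairLower hk]⟩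
  · exact ⟨(isNCPair_pairLower _ _).tensor (isNCPair_pairLower _ _), by
      rw [cval_wwbb]; exact dvd_zero _⟩

/-! ### Color words and labelled relations -/

/-- The word of upper colors. -/
def upWord (p : TCP) : List Color := List.ofFn p.upColor

/-- The word of lower colors. -/
def lowWord (p : TCP) : List Color := List.ofFn p.lowColor

theorem length_upWord (p : TCP) : (upWord p).length = p.k := List.length_ofFn

theorem length_lowWord (p : TCP) : (lowWord p).length = p.l := List.length_ofFn

theorem upWord_tensor (p q : TCP) : upWord (tensor p q) = upWord p ++ upWord q := by
  refine (List.ofFn_add (n := p.k) (m := q.k) (f := (tensor p q).upColor)).trans ?_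
  exact congrArg₂ (· ++ ·) (congrArg List.ofFn (funext (tensor_upColor_left p q)))
    (congrArg List.ofFn (funext (tensor_upColor_right p q)))

theorem lowWord_tensor (p q : TCP) : lowWord (tensor p q) = lowWord p ++ lowWord q := by
  refine (List.ofFn_add (n := p.l) (m := q.l) (f := (tensor p q).lowColor)).trans ?_
  exact congrArg₂ (· ++ ·) (congrArg List.ofFn (funext (tensor_lowColor_left p q)))
    (congrArg List.ofFn (funext (tensor_lowColor_right p q)))

theorem lowWord_eq_iff {q p : TCP} : lowWord q = upWord p ↔ ∃ h : q.l = p.k, ColorsMatch q p h := by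
  constructor
  · intro hw
    have h : q.l = p.k := by rw [← length_lowWord, hw, length_upWord]
    refine ⟨h, fun j => ?_⟩
    have h1 : List.ofFn q.lowColor = List.ofFn fun j => p.upColor (Fin.cast h j) :=
      hw.trans (List.ofFn_congr h.symm p.upColor)
    exact congrFun (List.ofFn_injective h1) j
  · rintro ⟨h, hc⟩
    rw [lowWord, List.ofFn_congr h]
    exact congrArg List.ofFn (funext fun j => hc _)

/-- The position of a point in its row. -/
def pos {k l : ℕ} : Fin k ⊕ Fin l → ℕ ⊕ ℕ := Sum.map Fin.val Fin.val

theorem pos_injective {k l : ℕ} : Function.Injective (pos (k := k) (l := l)) :=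
  Sum.map_injective.2 ⟨Fin.val_injective, Fin.val_injective⟩

/-- The relation between the positions of points in the same block. -/
def Joined (p : TCP) : ℕ ⊕ ℕ → ℕ ⊕ ℕ → Prop := Relation.Map p.rel pos pos

theorem Joined.symm {p : TCP} {u v : ℕ ⊕ ℕ} (h : Joined p u v) : Joined p v u := by
  obtain ⟨x, y, hxy, hx, hy⟩ := h
  exact ⟨y, x, p.rel.symm hxy, hy, hx⟩

theorem Joined.refl_left {p : TCP} {u v : ℕ ⊕ ℕ} (h : Joined p u v) : Joined p u u := by
  obtain ⟨x, y, hxy, hx, hy⟩ := h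
  exact ⟨x, x, p.rel.refl x, hx, hx⟩

theorem eq_of_joined {p q : TCP} (hu : upWord p = upWord q) (hl : lowWord p = lowWord q)
    (hp : IsPairing p.rel) (hq : IsPairing q.rel) (h : ∀ u v, Joined p u v → Joined q u v) :
    p = q := by
  obtain ⟨k, l, uc, lc, r⟩ := p
  obtain ⟨k', l', uc', lc', r'⟩ := q
  obtain rfl : k = k' := by simpa [upWord] using congrArg List.length hu
  obtain rfl : l = l' := by simpa [lowWord] using congrArg List.length hl
  obtain rfl : uc = uc' := List.ofFn_injective hu
  obtain rfl : lc = lc' := List.ofFn_injective hl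
  congr 1
  refine hp.eq_of_le hq fun x y hxy => ?_
  obtain ⟨x', y', hxy', hx, hy⟩ := h (pos x) (pos y) ⟨x, y, hxy, rfl, rfl⟩
  obtain rfl := pos_injective hx
  obtain rfl := pos_injective hy
  exact hxy'

/-- Shifting positions. -/
def shiftPos (p : TCP) : ℕ ⊕ ℕ → ℕ ⊕ ℕ := Sum.map (p.k + ·) (p.l + ·)

theorem Joined.tensor_left {p : TCP} (q : TCP) {u v : ℕ ⊕ ℕ} (h : Joined p u v) :
    Joined (tensor p q) u v := by
  obtain ⟨x, y, hxy, rfl, rfl⟩ := h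
  refine ⟨_, _, tensor_rel_left hxy, ?_, ?_⟩
  · rcases x with x | x <;> rfl
  · rcases y with y | y <;> rfl

theorem Joined.tensor_right (p : TCP) {q : TCP} {u v : ℕ ⊕ ℕ} (h : Joined q u v) :
    Joined (tensor p q) (shiftPos p u) (shiftPos p v) := by
  obtain ⟨x, y, hxy, rfl, rfl⟩ := h
  refine ⟨_, _, tensor_rel_right hxy, ?_, ?_⟩
  · rcases x with x | x <;> rfl
  · rcases y with y | y <;> rfl

theorem joined_invol {p : TCP} {u v : ℕ ⊕ ℕ} (h : Joined p u v) :
    Joined (invol p) u.swap v.swap := by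
  obtain ⟨x, y, hxy, rfl, rfl⟩ := h
  refine ⟨x.swap, y.swap, ?_, ?_, ?_⟩
  · change p.rel x.swap.swap y.swap.swap
    rwa [Sum.swap_swap, Sum.swap_swap]
  · rcases x with x | x <;> rfl
  · rcases y with y | y <;> rfl

theorem Joined.lt_of_inl {p : TCP} {n : ℕ} {v : ℕ ⊕ ℕ} (h : Joined p (.inl n) v) : n < p.k := by
  obtain ⟨x | x, y, -, hx, -⟩ := h
  · rw [← Sum.inl.inj hx]
    exact x.2
  · exact (Sum.inr_ne_inl hx).elim

theorem Joined.lt_of_inr {p : TCP} {n : ℕ} {v : ℕ ⊕ ℕ} (h : Joined p (.inr n) v) : n < p.l := by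
  obtain ⟨x | x, y, -, hx, -⟩ := h
  · exact (Sum.inl_ne_inr hx).elim
  · rw [← Sum.inr.inj hx]
    exact x.2

theorem joined_idPart (c : Color) : Joined (idPart c) (.inl 0) (.inr 0) :=
  ⟨.inl (0 : Fin 1), .inr (0 : Fin 1), trivial, rfl, rfl⟩

theorem joined_pairLower (c₁ c₂ : Color) : Joined (pairLower c₁ c₂) (.inr 0) (.inr 1) :=
  ⟨.inr (0 : Fin 2), .inr (1 : Fin 2), rfl, rfl, rfl⟩

/-- The relation between the positions of glued points in the same block; the three summands
are the upper, the middle and the lower row. -/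
def JoinedMid (q p : TCP) (h : q.l = p.k) : (ℕ ⊕ ℕ) ⊕ ℕ → (ℕ ⊕ ℕ) ⊕ ℕ → Prop :=
  Relation.Map (glue q p h) (Sum.map pos Fin.val) (Sum.map pos Fin.val)

theorem JoinedMid.symm {q p : TCP} {h : q.l = p.k} {u v} (huv : JoinedMid q p h u v) :
    JoinedMid q p h v u := by
  obtain ⟨x, y, hxy, hx, hy⟩ := huv
  exact ⟨y, x, Setoid.symm' _ hxy, hy, hx⟩

theorem JoinedMid.trans {q p : TCP} {h : q.l = p.k} {u v w} (huv : JoinedMid q p h u v)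
    (hvw : JoinedMid q p h v w) : JoinedMid q p h u w := by
  obtain ⟨x, y, hxy, hx, hy⟩ := huv
  obtain ⟨y', z, hyz, hy', hz⟩ := hvw
  have : y = y' :=
    Sum.map_injective.2 ⟨pos_injective, Fin.val_injective⟩ (hy.trans hy'.symm)
  subst this
  exact ⟨x, z, Setoid.trans' _ hxy hyz, hx, hz⟩

theorem Joined.mid_fst {q : TCP} {u v : ℕ ⊕ ℕ} (huv : Joined q u v) (p : TCP) (h : q.l = p.k) :
    JoinedMid q p h (.inl u) (.inl v) := by
  obtain ⟨x, y, hxy, rfl, rfl⟩ := huv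
  exact ⟨.inl x, .inl y, glue_of_fst h hxy, rfl, rfl⟩

/-- The glued position of a position of the lower factor. -/
def midPos : ℕ ⊕ ℕ → (ℕ ⊕ ℕ) ⊕ ℕ := Sum.elim (fun n => .inl (.inr n)) .inr

theorem Joined.mid_snd {p : TCP} {u v : ℕ ⊕ ℕ} (huv : Joined p u v) (q : TCP) (h : q.l = p.k) :
    JoinedMid q p h (midPos u) (midPos v) := by
  obtain ⟨x, y, hxy, rfl, rfl⟩ := huv
  refine ⟨_, _, glue_of_snd h hxy, ?_, ?_⟩
  · rcases x with x | x <;> rfl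
  · rcases y with y | y <;> rfl

/-- The glued position of a position of the composition. -/
def outerPos : ℕ ⊕ ℕ → (ℕ ⊕ ℕ) ⊕ ℕ := Sum.elim (fun n => .inl (.inl n)) .inr

theorem joined_comp {q p : TCP} {h : q.l = p.k} {u v : ℕ ⊕ ℕ}
    (huv : JoinedMid q p h (outerPos u) (outerPos v)) : Joined (comp q p h) u v := by
  have key : ∀ (t : (Fin q.k ⊕ Fin q.l) ⊕ Fin p.l) (w : ℕ ⊕ ℕ),
      Sum.map pos Fin.val t = outerPos w → ∃ x, outer q p x = t ∧ pos x = w := by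
    rintro ((t | t) | t) (w | w) ht
    · exact ⟨.inl t, rfl, congrArg Sum.inl (Sum.inl.inj (Sum.inl.inj ht))⟩
    · exact (Sum.inl_ne_inr ht).elim
    · exact (Sum.inr_ne_inl (Sum.inl.inj ht)).elim
    · exact (Sum.inl_ne_inr ht).elim
    · exact (Sum.inr_ne_inl ht).elim
    · exact ⟨.inr t, rfl, congrArg Sum.inr (Sum.inr.inj ht)⟩
  obtain ⟨t, t', htt, ht, ht'⟩ := huv
  obtain ⟨x, rfl, hx⟩ := key t u ht
  obtain ⟨y, rfl, hy⟩ := key t' v ht'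
  exact ⟨x, y, htt, hx, hy⟩

theorem Joined.comp_fst {q p : TCP} {h : q.l = p.k} {u v : ℕ ⊕ ℕ} (huv : Joined q u v)
    (hp : ∀ n < p.k, Joined p (.inl n) (.inr n)) : Joined (comp q p h) u v := by
  have key : ∀ {u v}, Joined q u v → JoinedMid q p h (outerPos u) (.inl u) := by
    rintro (u | u) v huv
    · exact huv.refl_left.mid_fst p h
    · exact ((hp u (h ▸ huv.lt_of_inr)).mid_snd q h).symm
  exact joined_comp ((key huv).trans ((huv.mid_fst p h).trans (key huv.symm).symm))

theorem Joined.comp_snd {q p : TCP} {h : q.l = p.k} {u v : ℕ ⊕ ℕ} (huv : Joined p u v)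
    (hu : ∀ n, u = .inl n → Joined q (.inl n) (.inr n))
    (hv : ∀ n, v = .inl n → Joined q (.inl n) (.inr n)) : Joined (comp q p h) u v := by
  have key : ∀ {u v}, Joined p u v → (∀ n, u = .inl n → Joined q (.inl n) (.inr n)) →
      JoinedMid q p h (outerPos u) (midPos u) := by
    rintro (u | u) v huv hu
    · exact (hu u rfl).mid_fst p h
    · exact huv.refl_left.mid_snd q h
  exact joined_comp ((key huv hu).trans ((huv.mid_snd q h).trans (key huv.symm hv).symm))

/-! ### Through-strings -/

/-- Vertical strings with prescribed upper and lower colors. -/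
def strands (w w' : List Color) : TCP where
  k := w.length
  l := w'.length
  upColor := w.get
  lowColor := w'.get
  rel := Setoid.ker (Sum.elim Fin.val Fin.val)

theorem upWord_strands (w w' : List Color) : upWord (strands w w') = w := List.ofFn_get w

theorem lowWord_strands (w w' : List Color) : lowWord (strands w w') = w' := List.ofFn_get w'

theorem isPairing_strands {w w' : List Color} (h : w.length = w'.length) :
    IsPairing (strands w w').rel := by
  rintro (x | x)
  · refine ⟨.inr (Fin.cast h x), Sum.inr_ne_inl, ?_⟩
    rintro (z | z)
    · exact ⟨fun hz => Or.inl (congrArg _ (Fin.ext hz.symm)), fun hz => by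
        rcases hz with hz | hz
        · rw [hz]
        · exact (Sum.inl_ne_inr hz).elim⟩
    · exact ⟨fun hz => Or.inr (congrArg _ (Fin.ext hz.symm)), fun hz => by
        rcases hz with hz | hz
        · exact (Sum.inr_ne_inl hz).elim
        · rw [hz]
          rfl⟩
  · refine ⟨.inl (Fin.cast h.symm x), Sum.inl_ne_inr, ?_⟩
    rintro (z | z)
    · exact ⟨fun hz => Or.inr (congrArg _ (Fin.ext hz.symm)), fun hz => by
        rcases hz with hz | hz
        · exact (Sum.inl_ne_inr hz).elim
        · rw [hz]
          rfl⟩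
    · exact ⟨fun hz => Or.inl (congrArg _ (Fin.ext hz.symm)), fun hz => by
        rcases hz with hz | hz
        · rw [hz]
        · exact (Sum.inr_ne_inl hz).elim⟩

theorem joined_strands {w w' : List Color} {n : ℕ} (h : n < w.length) (h' : n < w'.length) :
    Joined (strands w w') (.inl n) (.inr n) :=
  ⟨.inl ⟨n, h⟩, .inr ⟨n, h'⟩, rfl, rfl, rfl⟩

/-- To compare a partition with through-strings, it suffices to follow the strings. -/
theorem strands_eq {w w' : List Color} (hlen : w.length = w'.length) {q : TCP}
    (hu : upWord q = w) (hl : lowWord q = w') (hq : IsPairing q.rel)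
    (h : ∀ n < w.length, Joined q (.inl n) (.inr n)) : strands w w' = q := by
  refine eq_of_joined (by rw [upWord_strands, hu]) (by rw [lowWord_strands, hl])
    (isPairing_strands hlen) hq ?_
  rintro _ _ ⟨x | x, y | y, hxy, rfl, rfl⟩
  · obtain rfl : x = y := Fin.ext hxy
    exact (h _ x.2).refl_left
  · have hxy' : x.1 = y.1 := hxy
    change Joined q (.inl x.1) (.inr y.1)
    rw [← hxy']
    exact h _ x.2
  · have hxy' : x.1 = y.1 := hxy
    change Joined q (.inr x.1) (.inl y.1)
    rw [hxy']
    exact (h _ y.2).symm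
  · obtain rfl : x = y := Fin.ext hxy
    exact (h x.1 (hlen ▸ x.2)).symm.refl_left

theorem strands_singleton (c : Color) : strands [c] [c] = idPart c := by
  refine strands_eq rfl (by simp [upWord, idPart]) (by simp [lowWord, idPart])
    (isPairing_idPart c) fun n hn => ?_
  obtain rfl : n = 0 := by simpa using hn
  exact joined_idPart c

theorem strands_append {x x' y y' : List Color} (hx : x.length = x'.length)
    (hy : y.length = y'.length) :
    strands (x ++ y) (x' ++ y') = tensor (strands x x') (strands y y') := by
  refine strands_eq (by simp [hx, hy]) (by simp only [upWord_tensor, upWord_strands])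
    (by simp only [lowWord_tensor, lowWord_strands])
    ((isPairing_strands hx).tensor (isPairing_strands hy)) fun n hn => ?_
  rw [List.length_append] at hn
  by_cases h : n < x.length
  · exact (joined_strands h (hx ▸ h)).tensor_left _
  · have h1 := (joined_strands (w := y) (w' := y') (n := n - x.length) (by omega)
      (by omega)).tensor_right (strands x x')
    have h2 : x.length + (n - x.length) = n := by omega
    have h3 : x'.length + (n - x.length) = n := by omega
    change Joined _ (.inl (x.length + (n - x.length))) (.inr (x'.length + (n - x.length))) at h1
    rwa [h2, h3] at h1

theorem cval_eq_words (p : TCP) :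
    cval p = ((lowWord p).map colorSign).sum - ((upWord p).map colorSign).sum := by
  rw [cval_eq_sum, lowWord, upWord, List.map_ofFn, List.map_ofFn, List.sum_ofFn, List.sum_ofFn]
  rfl

/-! ### Partitions in a category containing `wwbb` -/

section Category

variable {C : Set TCP}

theorem IsCategory.idPart_mem (hC : IsCategory C) (c : Color) : idPart c ∈ C := by
  cases c
  · exact hC.idb_mem
  · exact hC.idw_mem

theorem IsCategory.pair_mem (hC : IsCategory C) (c : Color) : pairLower c (!c) ∈ C := by
  cases c
  · exact hC.pairbw_mem
  · exact hC.pairwb_mem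

theorem lowWord_pairLower (c₁ c₂ : Color) : lowWord (pairLower c₁ c₂) = [c₁, c₂] := by
  simp [lowWord, pairLower, mkLower, List.ofFn_succ]

theorem upWord_pairLower (c₁ c₂ : Color) : upWord (pairLower c₁ c₂) = [] := rfl

theorem lowWord_idPart (c : Color) : lowWord (idPart c) = [c] := by simp [lowWord, idPart]

theorem upWord_idPart (c : Color) : upWord (idPart c) = [c] := by simp [upWord, idPart]

theorem lowWord_invol (p : TCP) : lowWord (invol p) = upWord p := rfl

theorem upWord_invol (p : TCP) : upWord (invol p) = lowWord p := rfl

theorem lowWord_comp (q p : TCP) (h : q.l = p.k) : lowWord (comp q p h) = lowWord p := rfl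

theorem upWord_comp (q p : TCP) (h : q.l = p.k) : upWord (comp q p h) = upWord q := rfl

theorem strands_comp_mem (hC : IsCategory C) {w₁ w₂ w₃ : List Color}
    (h₁ : w₁.length = w₂.length) (h₂ : w₂.length = w₃.length) (h₁₂ : strands w₁ w₂ ∈ C)
    (h₂₃ : strands w₂ w₃ ∈ C) : strands w₁ w₃ ∈ C := by
  obtain ⟨h, hc⟩ := lowWord_eq_iff.1
    ((lowWord_strands w₁ w₂).trans (upWord_strands w₂ w₃).symm)
  rw [strands_eq (q := comp (strands w₁ w₂) (strands w₂ w₃) h) (h₁.trans h₂)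
    (upWord_strands w₁ w₂) (lowWord_strands w₂ w₃)
    ((isPairing_strands h₁).comp (isPairing_strands h₂) h)]
  · exact hC.comp_mem _ h₁₂ _ h₂₃ h hc
  · intro n hn
    exact (joined_strands hn (h₁ ▸ hn)).comp_fst fun m hm => joined_strands hm (h₂ ▸ hm)

theorem strands_symm_mem (hC : IsCategory C) {w w' : List Color} (h : w.length = w'.length)
    (hw : strands w w' ∈ C) : strands w' w ∈ C := by
  rw [strands_eq (q := invol (strands w w')) h.symm (lowWord_strands w w') (upWord_strands w w')
    (isPairing_strands h).invol]
  · exact hC.invol_mem _ hw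
  · intro n hn
    exact joined_invol (joined_strands (h ▸ hn) hn).symm

theorem strands_nil_mem (hC : IsCategory C) : strands [] [] ∈ C := by
  have h : (pairLower white black).l = (invol (pairLower white black)).k := rfl
  rw [strands_eq (w := []) (w' := [])
    (q := comp (pairLower white black) (invol (pairLower white black)) h) rfl rfl rfl
    ((isPairing_pairLower _ _).comp (isPairing_pairLower _ _).invol h)
    fun n hn => absurd hn (Nat.not_lt_zero n)]
  exact hC.comp_mem _ hC.pairwb_mem _ (hC.invol_mem _ hC.pairwb_mem) h fun _ => rfl

theorem strands_append_mem (hC : IsCategory C) {x x' y y' : List Color}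
    (hx : x.length = x'.length) (hy : y.length = y'.length) (h₁ : strands x x' ∈ C)
    (h₂ : strands y y' ∈ C) : strands (x ++ y) (x' ++ y') ∈ C := by
  rw [strands_append hx hy]
  exact hC.tensor_mem _ h₁ _ h₂

theorem strands_self_mem (hC : IsCategory C) (w : List Color) : strands w w ∈ C := by
  induction w with
  | nil => exact strands_nil_mem hC
  | cons c w ih =>
    refine strands_append_mem hC (x := [c]) (x' := [c]) rfl rfl ?_ ih
    rw [strands_singleton]
    exact hC.idPart_mem c

theorem strands_bwwb_mem (hC : IsCategory C) (hwb : wwbb ∈ C) :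
    strands [black, white] [white, black] ∈ C := by
  let cap : TCP := invol (pairLower black white)
  let top : TCP := tensor (tensor (idPart black) wwbb) (idPart white)
  let bot : TCP := tensor (tensor cap (tensor (idPart white) (idPart black))) cap
  have hcap : cap ∈ C := hC.invol_mem _ hC.pairbw_mem
  have htop : top ∈ C := hC.tensor_mem _ (hC.tensor_mem _ hC.idb_mem _ hwb) _ hC.idw_mem
  have hbot : bot ∈ C := hC.tensor_mem _ (hC.tensor_mem _ hcap _
    (hC.tensor_mem _ hC.idw_mem _ hC.idb_mem)) _ hcap
  have hpcap : IsPairing cap.rel := (isPairing_pairLower _ _).invol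
  have hptop : IsPairing top.rel := ((isPairing_idPart _).tensor
    ((isPairing_pairLower _ _).tensor (isPairing_pairLower _ _))).tensor (isPairing_idPart _)
  have hpbot : IsPairing bot.rel := (hpcap.tensor
    ((isPairing_idPart _).tensor (isPairing_idPart _))).tensor hpcap
  obtain ⟨h, hc⟩ := (lowWord_eq_iff (q := top) (p := bot)).1 (by
    simp only [top, bot, cap, wwbb, lowWord_tensor, upWord_tensor, upWord_invol, lowWord_pairLower,
      lowWord_idPart, upWord_idPart]
    rfl)
  rw [strands_eq (w := [black, white]) (w' := [white, black]) (q := comp top bot h) rfl _ _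
    (hptop.comp hpbot h)]
  · exact hC.comp_mem _ htop _ hbot h hc
  · have hcapj : Joined cap (.inl 0) (.inl 1) := joined_invol (joined_pairLower black white)
    have t1 : Joined top (.inl 0) (.inr 0) :=
      ((joined_idPart black).tensor_left wwbb).tensor_left (idPart white)
    have t2 : Joined top (.inr 1) (.inr 2) :=
      (((joined_pairLower white white).tensor_left (pairLower black black)).tensor_right
        (idPart black)).tensor_left (idPart white)
    have t3 : Joined top (.inr 3) (.inr 4) :=
      (((joined_pairLower black black).tensor_right (pairLower white white)).tensor_right
        (idPart black)).tensor_left (idPart white)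
    have t4 : Joined top (.inl 1) (.inr 5) :=
      (joined_idPart white).tensor_right (tensor (idPart black) wwbb)
    have b1 : Joined bot (.inl 0) (.inl 1) :=
      (hcapj.tensor_left (tensor (idPart white) (idPart black))).tensor_left cap
    have b2 : Joined bot (.inl 2) (.inr 0) :=
      (((joined_idPart white).tensor_left (idPart black)).tensor_right cap).tensor_left cap
    have b3 : Joined bot (.inl 3) (.inr 1) :=
      (((joined_idPart black).tensor_right (idPart white)).tensor_right cap).tensor_left cap
    have b4 : Joined bot (.inl 4) (.inl 5) :=
      hcapj.tensor_right (tensor cap (tensor (idPart white) (idPart black)))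
    intro n hn
    have hn' : n < 2 := hn
    rcases (by omega : n = 0 ∨ n = 1) with rfl | rfl
    · exact joined_comp ((t1.mid_fst bot h).trans ((b1.mid_snd top h).trans
        ((t2.mid_fst bot h).trans (b2.mid_snd top h))))
    · exact joined_comp ((t4.mid_fst bot h).trans ((b4.symm.mid_snd top h).trans
        ((t3.symm.mid_fst bot h).trans (b3.mid_snd top h))))
  · simp only [upWord_comp, top, wwbb, upWord_tensor, upWord_idPart, upWord_pairLower]
    rfl
  · simp only [lowWord_comp, bot, cap, lowWord_tensor, lowWord_idPart, lowWord_invol,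
      upWord_pairLower]
    rfl

theorem strands_mem_of_perm (hC : IsCategory C) (hwb : wwbb ∈ C) {w w' : List Color}
    (h : w.Perm w') : strands w w' ∈ C := by
  induction h with
  | nil => exact strands_nil_mem hC
  | cons c hp ih =>
    exact strands_append_mem hC (x := [c]) (x' := [c]) rfl hp.length_eq (strands_self_mem hC _) ih
  | swap a b w =>
    refine strands_append_mem hC (x := [b, a]) (x' := [a, b]) rfl rfl ?_ (strands_self_mem hC w)
    cases a <;> cases b
    · exact strands_self_mem hC _
    · exact strands_symm_mem hC rfl (strands_bwwb_mem hC hwb)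
    · exact strands_bwwb_mem hC hwb
    · exact strands_self_mem hC _
  | trans h₁ h₂ ih₁ ih₂ => exact strands_comp_mem hC h₁.length_eq h₂.length_eq ih₁ ih₂

theorem sum_colorSign_eq_count (w : List Color) :
    (w.map colorSign).sum = (w.count true : ℤ) - w.count false := by
  induction w with
  | nil => rfl
  | cons c w ih =>
    rw [List.map_cons, List.sum_cons, ih]
    cases c
    · change -1 + _ = _
      simp
      ring
    · change 1 + _ = _
      simp
      ring

theorem perm_of_sum_colorSign {w w' : List Color} (hl : w.length = w'.length)
    (hs : (w.map colorSign).sum = (w'.map colorSign).sum) : w.Perm w' := by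
  rw [sum_colorSign_eq_count, sum_colorSign_eq_count] at hs
  have h1 := List.count_true_add_count_false w
  have h2 := List.count_true_add_count_false w'
  rw [List.perm_iff_count]
  intro c
  cases c <;> omega

theorem cval_strands_self (w : List Color) : cval (strands w w) = 0 := by
  rw [cval_eq_words, upWord_strands, lowWord_strands, sub_self]

theorem IsPairing.eq_or_eq {α : Type*} {r : Setoid α} (h : IsPairing r) {x y z : α} (hxy : r x y)
    (hne : x ≠ y) (hxz : r x z) : z = x ∨ z = y := by
  obtain ⟨c, -, hc⟩ := h x
  rw [((hc y).1 hxy).resolve_left hne.symm]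
  exact (hc z).1 hxz

/-- The shape of a noncrossing pair partition is realized by a member of the category whose
color sum vanishes. -/
theorem exists_mem_same_shape (hC : IsCategory C) {p : TCP} (hp : IsNCPair p) (hk : p.k = 0) :
    ∃ r ∈ C, r.k = 0 ∧ r.l = p.l ∧ IsPairing r.rel ∧ cval r = 0 ∧
      ∀ u v, Joined p u v → Joined r u v := by
  refine hp.induction_line (P := fun p => ∃ r ∈ C, r.k = 0 ∧ r.l = p.l ∧ IsPairing r.rel ∧
    cval r = 0 ∧ ∀ u v, Joined p u v → Joined r u v) ?_ ?_ hk
  · intro p hk hl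
    refine ⟨strands [] [], strands_nil_mem hC, rfl, hl.symm, isPairing_strands rfl,
      cval_strands_self [], ?_⟩
    rintro (u | u) v huv
    · have := huv.lt_of_inl
      omega
    · have := huv.lt_of_inr
      omega
  · rintro p i hi hp hk hr ⟨r, hrC, hrk, hrl, hrp, hrc, hrj⟩
    have hrl' : r.l = p.l - 2 := hrl
    let x : List Color := (lowWord r).take i
    let y : List Color := (lowWord r).drop i
    have hx : x.length = i := by
      simp only [x, List.length_take, length_lowWord]
      omega
    have hy : y.length = p.l - 2 - i := by
      simp only [y, List.length_drop, length_lowWord]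
      omega
    let d : TCP := tensor (tensor (strands x x) (pairLower white black)) (strands y y)
    have hdp : IsPairing d.rel :=
      ((isPairing_strands rfl).tensor (isPairing_pairLower _ _)).tensor (isPairing_strands rfl)
    have hdC : d ∈ C := hC.tensor_mem _ (hC.tensor_mem _ (strands_self_mem hC x) _ hC.pairwb_mem) _
      (strands_self_mem hC y)
    have hdc : cval d = 0 := by
      simp only [d, cval_tensor, cval_strands_self, cval_pairLower]
      rfl
    obtain ⟨h, hc⟩ := (lowWord_eq_iff (q := r) (p := d)).1 (by
      simp only [d, upWord_tensor, upWord_strands, upWord_pairLower, List.append_nil, x, y,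
        List.take_append_drop])
    have hdl : d.l = p.l := by
      change x.length + 2 + y.length = p.l
      omega
    refine ⟨comp r d h, hC.comp_mem _ hrC _ hdC h hc, hrk, hdl, hrp.comp hdp h, ?_, ?_⟩
    · rw [cval_comp r d h hc, hrc, hdc, add_zero]
    have hpair : Joined d (.inr i) (.inr (i + 1)) := by
      have h1 := ((joined_pairLower white black).tensor_right (strands x x)).tensor_left
        (strands y y)
      change Joined d (.inr (x.length + 0)) (.inr (x.length + 1)) at h1
      rwa [hx] at h1
    have hstr : ∀ m : Fin (p.l - 2), Joined d (.inl m.1) (.inr (skipTwo (n := p.l) i m).1) := by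
      intro m
      rw [skipTwo_val]
      split_ifs with hm
      · exact ((joined_strands (hx ▸ hm) (hx ▸ hm)).tensor_left _).tensor_left _
      · have hmy : m.1 - i < y.length := by omega
        have h1 := (joined_strands hmy hmy).tensor_right
          (tensor (strands x x) (pairLower white black))
        change Joined d (.inl (x.length + 0 + (m.1 - i))) (.inr (x.length + 2 + (m.1 - i))) at h1
        rw [hx] at h1
        convert h1 using 2 <;> omega
    have hcases : ∀ a : Fin p.l, (a.1 = i ∨ a.1 = i + 1) ∨ ∃ m, skipTwo i m = a := by
      intro a
      by_cases ha : a.1 = i ∨ a.1 = i + 1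
      · exact Or.inl ha
      · refine Or.inr ⟨⟨if a.1 < i then a.1 else a.1 - 2, by split_ifs <;> omega⟩, Fin.ext ?_⟩
        rw [skipTwo_val]
        dsimp only
        split_ifs <;> omega
    have hout : ∀ (m : Fin (p.l - 2)) (b : Fin p.l), b.1 = i ∨ b.1 = i + 1 →
        ¬ p.rel (.inr b) (.inr (skipTwo i m)) := by
      intro m b hb hbm
      have h1 : p.rel (.inr ⟨i, by omega⟩) (.inr (skipTwo i m)) := by
        rcases hb with hb | hb
        · rwa [show b = ⟨i, by omega⟩ from Fin.ext hb] at hbm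
        · rw [show b = ⟨i + 1, hi⟩ from Fin.ext hb] at hbm
          exact p.rel.trans hr hbm
      have h2 := skipTwo_val (n := p.l) i m
      rcases hp.2.eq_or_eq hr (by simp) h1 with h3 | h3
      · have h4 := congrArg Fin.val (Sum.inr.inj h3)
        dsimp only at h4
        split_ifs at h2 <;> omega
      · have h4 := congrArg Fin.val (Sum.inr.inj h3)
        dsimp only at h4
        split_ifs at h2 <;> omega
    rintro _ _ ⟨a | a, b | b, hab, rfl, rfl⟩
    · have := a.2
      omega
    · have := a.2
      omega
    · have := b.2
      omega
    refine joined_comp ?_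
    change JoinedMid r d h (.inr a.1) (.inr b.1)
    rcases hcases a with ha | ⟨a, rfl⟩ <;> rcases hcases b with hb | ⟨b, rfl⟩
    · refine Joined.mid_snd (u := .inr a.1) (v := .inr b.1) ?_ r h
      rcases ha with ha | ha <;> rcases hb with hb | hb <;> rw [ha, hb]
      · exact hpair.refl_left
      · exact hpair
      · exact hpair.symm
      · exact hpair.symm.refl_left
    · exact (hout _ _ ha hab).elim
    · exact (hout _ _ hb (p.rel.symm hab)).elim
    · have h1 : Joined r (.inr a.1) (.inr b.1) := hrj _ _ ⟨.inr a, .inr b, hab, rfl, rfl⟩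
      exact ((hstr a).mid_snd r h).symm.trans ((h1.mid_fst d h).trans ((hstr b).mid_snd r h))

theorem mem_of_cval_eq_zero_of_line (hC : IsCategory C) (hwb : wwbb ∈ C) {p : TCP}
    (hp : IsNCPair p) (hk : p.k = 0) (hc : cval p = 0) : p ∈ C := by
  obtain ⟨r, hrC, hrk, hrl, hrp, hrc, hrj⟩ := exists_mem_same_shape hC hp hk
  have hnil : ∀ {q : TCP}, q.k = 0 → upWord q = [] := by
    intro q hq
    rw [← List.length_eq_zero_iff, length_upWord, hq]
  have hlen : (lowWord r).length = (lowWord p).length := by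
    rw [length_lowWord, length_lowWord, hrl]
  have hperm : (lowWord r).Perm (lowWord p) := by
    refine perm_of_sum_colorSign hlen ?_
    rw [cval_eq_words, hnil hk] at hc
    rw [cval_eq_words, hnil hrk] at hrc
    simpa using hrc.trans hc.symm
  obtain ⟨h, hm⟩ := (lowWord_eq_iff (q := r) (p := strands (lowWord r) (lowWord p))).1
    (upWord_strands _ _).symm
  rw [eq_of_joined (q := comp r (strands (lowWord r) (lowWord p)) h)
    ((hnil hk).trans (hnil hrk).symm) (lowWord_strands (lowWord r) (lowWord p)).symm hp.2
    (hrp.comp (isPairing_strands hlen) h)]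
  · exact hC.comp_mem _ hrC _ (strands_mem_of_perm hC hwb hperm) h hm
  · intro u v huv
    exact (hrj u v huv).comp_fst fun n hn => joined_strands hn (hlen ▸ hn)

theorem lowWord_rotULdown (p : TCP) (h : 0 < p.k) :
    lowWord (rotULdown p h) = (!p.upColor ⟨0, h⟩) :: lowWord p := by
  refine (List.ofFn_succ (n := p.l)).trans ?_
  rfl

theorem upWord_eq_cons_rotULdown (p : TCP) (h : 0 < p.k) :
    upWord p = p.upColor ⟨0, h⟩ :: upWord (rotULdown p h) :=
  ofFn_eq_cons h _

theorem cval_rotULdown (p : TCP) (h : 0 < p.k) : cval (rotULdown p h) = cval p := by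
  rw [cval_eq_words, cval_eq_words, lowWord_rotULdown, upWord_eq_cons_rotULdown p h]
  have hs : ∀ c, colorSign (!c) = -colorSign c := by decide
  rw [List.map_cons, List.map_cons, List.sum_cons, List.sum_cons, hs]
  ring

/-- The position of a point after rotating the leftmost upper point down. -/
def rotPos : ℕ ⊕ ℕ → ℕ ⊕ ℕ
  | .inl 0 => .inr 0
  | .inl (n + 1) => .inl n
  | .inr n => .inr (n + 1)

theorem Joined.rotULdown {p : TCP} {u v : ℕ ⊕ ℕ} (huv : Joined p u v) (h : 0 < p.k) :
    Joined (rotULdown p h) (rotPos u) (rotPos v) := by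
  have key : ∀ x : Fin p.k ⊕ Fin p.l, ∃ x', rotPt p h x' = x ∧ pos x' = rotPos (pos x) := by
    rintro (⟨_ | n, hx⟩ | x)
    · exact ⟨.inr ⟨0, by omega⟩, rfl, rfl⟩
    · exact ⟨.inl ⟨n, by omega⟩, rfl, rfl⟩
    · exact ⟨.inr ⟨x.1 + 1, by omega⟩, rfl, rfl⟩
  obtain ⟨x, y, hxy, rfl, rfl⟩ := huv
  obtain ⟨x', rfl, hx⟩ := key x
  obtain ⟨y', rfl, hy⟩ := key y
  exact ⟨x', y', hxy, hx, hy⟩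

theorem mem_of_rotULdown_mem (hC : IsCategory C) {p : TCP} (hp : IsNCPair p) (h0 : 0 < p.k)
    (hr : rotULdown p h0 ∈ C) : p ∈ C := by
  let a : Color := p.upColor ⟨0, h0⟩
  let w : List Color := lowWord p
  let top : TCP := tensor (idPart a) (rotULdown p h0)
  let bot : TCP := tensor (invol (pairLower a (!a))) (strands w w)
  have htop : top ∈ C := hC.tensor_mem _ (hC.idPart_mem a) _ hr
  have hbot : bot ∈ C := hC.tensor_mem _ (hC.invol_mem _ (hC.pair_mem a)) _ (strands_self_mem hC w)
  obtain ⟨h, hc⟩ := (lowWord_eq_iff (q := top) (p := bot)).1 (by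
    simp only [top, bot, lowWord_tensor, upWord_tensor, lowWord_idPart, upWord_invol,
      lowWord_pairLower, upWord_strands, lowWord_rotULdown]
    rfl)
  rw [eq_of_joined (q := comp top bot h) _ _ hp.2
    (((isPairing_idPart a).tensor (hp.rotULdown h0).2).comp
      ((isPairing_pairLower _ _).invol.tensor (isPairing_strands rfl)) h)]
  · exact hC.comp_mem _ htop _ hbot h hc
  · have key : ∀ {u v}, Joined p u v →
        JoinedMid top bot h (outerPos u) (.inl (shiftPos (idPart a) (rotPos u))) := by
      rintro ((_ | n) | n) v huv
      · have h1 : Joined top (.inl 0) (.inr 0) := (joined_idPart a).tensor_left _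
        have h2 : Joined bot (.inl 0) (.inl 1) :=
          (joined_invol (joined_pairLower a (!a))).tensor_left _
        exact (h1.mid_fst bot h).trans (h2.mid_snd top h)
      · have h1 := ((huv.rotULdown h0).tensor_right (idPart a)).refl_left.mid_fst bot h
        change JoinedMid top bot h (.inl (.inl (1 + n))) (.inl (.inl (1 + n))) at h1
        change JoinedMid top bot h (.inl (.inl (n + 1))) (.inl (.inl (1 + n)))
        rwa [Nat.add_comm n 1]
      · have hn : n < w.length := (length_lowWord p).symm ▸ huv.lt_of_inr
        have h1 := ((joined_strands hn hn).tensor_right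
          (invol (pairLower a (!a)))).mid_snd top h
        change JoinedMid top bot h (.inl (.inr (2 + n))) (.inr (0 + n)) at h1
        change JoinedMid top bot h (.inr n) (.inl (.inr (1 + (n + 1))))
        rw [Nat.zero_add] at h1
        rw [show 1 + (n + 1) = 2 + n by omega]
        exact h1.symm
    intro u v huv
    have h1 := ((huv.rotULdown h0).tensor_right (idPart a)).mid_fst bot h
    exact joined_comp ((key huv).trans (h1.trans (key huv.symm).symm))
  · rw [upWord_comp, upWord_tensor, upWord_idPart, upWord_eq_cons_rotULdown p h0]
    rfl
  · rw [lowWord_comp, lowWord_tensor, lowWord_invol, lowWord_strands]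
    rfl

theorem mem_of_cval_eq_zero (hC : IsCategory C) (hwb : wwbb ∈ C) {p : TCP}
    (hp : IsNCPair p) (hc : cval p = 0) : p ∈ C := by
  revert hc
  refine hp.induction_rot (P := fun p => cval p = 0 → p ∈ C) (fun p hp hk hc => mem_of_cval_eq_zero_of_line hC hwb hp hk hc) ?_
  intro p h hp ih hc
  exact mem_of_rotULdown_mem hC hp h (ih ((cval_rotULdown p h).trans hc))

theorem mem_of_cval_eq (hC : IsCategory C) (hwb : wwbb ∈ C) {p s : TCP} (hp : IsNCPair p)
    (hs : IsNCPair s) (hsC : s ∈ C) (hsk : s.k = 0) (hc : cval p = cval s) : p ∈ C := by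
  let top : TCP := tensor (strands (upWord p) (upWord p)) s
  let bot : TCP := tensor p (invol s)
  have htop : top ∈ C := hC.tensor_mem _ (strands_self_mem hC _) _ hsC
  have hbot : bot ∈ C := mem_of_cval_eq_zero hC hwb (hp.tensor hs.invol) (by
    rw [cval_tensor, cval_invol, hc, add_neg_cancel])
  have hnil : upWord s = [] := by rw [← List.length_eq_zero_iff, length_upWord, hsk]
  obtain ⟨h, hm⟩ := (lowWord_eq_iff (q := top) (p := bot)).1 (by
    simp only [top, bot, lowWord_tensor, upWord_tensor, lowWord_strands, upWord_invol])
  rw [eq_of_joined (q := comp top bot h) _ _ hp.2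
    (((isPairing_strands rfl).tensor hs.2).comp (hp.2.tensor hs.2.invol) h)]
  · exact hC.comp_mem _ htop _ hbot h hm
  · have key : ∀ {n v}, Joined p (.inl n) v → Joined top (.inl n) (.inr n) := by
      intro n v huv
      have hn : n < (upWord p).length := (length_upWord p).symm ▸ huv.lt_of_inl
      exact (joined_strands hn hn).tensor_left s
    intro u v huv
    refine (huv.tensor_left (invol s)).comp_snd ?_ ?_
    · rintro n rfl
      exact key huv
    · rintro n rfl
      exact key huv.symm
  · rw [upWord_comp, upWord_tensor, upWord_strands, hnil, List.append_nil]
  · rw [lowWord_comp, lowWord_tensor, lowWord_invol, hnil, List.append_nil]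

theorem tensorPow_k {p : TCP} (hp : p.k = 0) (n : ℕ) : (tensorPow p n).k = 0 := by
  induction n with
  | zero => rfl
  | succ n ih =>
    change (tensorPow p n).k + p.k = 0
    rw [ih, hp]

theorem tensorPow_mem (hC : IsCategory C) (hwb : wwbb ∈ C) {p : TCP} (hp : p ∈ C) (n : ℕ) :
    tensorPow p n ∈ C := by
  induction n with
  | zero =>
    refine mem_of_cval_eq_zero hC hwb (isNCPair_of_no_points rfl rfl) ?_
    exact (cval_tensorPow p 0).trans (by simp)
  | succ n ih => exact hC.tensor_mem _ ih _ hp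

theorem mem_of_dvd_cval (hC : IsCategory C) (hwb : wwbb ∈ C) {k : ℕ} (hk : Even k)
    (hg : tensorPow (pairLower white white) (k / 2) ∈ C) {p : TCP} (hp : IsNCPair p)
    (hc : (k : ℤ) ∣ cval p) : p ∈ C := by
  have key : ∀ {p : TCP} (n : ℕ), IsNCPair p → cval p = k * n → p ∈ C := by
    intro p n hp hc
    refine mem_of_cval_eq hC hwb hp
      (isNCPair_tensorPow (isNCPair_tensorPow (isNCPair_pairLower white white) (k / 2)) n)
      (tensorPow_mem hC hwb hg n) (tensorPow_k (tensorPow_k rfl _) n) ?_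
    rw [hc, cval_tensorPow, cval_tensorPow_pairLower hk, mul_comm]
  obtain ⟨t, ht⟩ := hc
  rcases Int.eq_nat_or_neg t with ⟨n, rfl | rfl⟩
  · exact key n hp ht
  · have h1 : invol p ∈ C := key n hp.invol (by rw [cval_invol, ht]; ring)
    have h2 : invol (invol p) = p := by
      refine eq_of_joined rfl rfl hp.invol.invol.2 hp.2 fun u v huv => ?_
      obtain ⟨x, y, hxy, hx, hy⟩ := huv
      refine ⟨x, y, ?_, hx, hy⟩
      have hxy' : p.rel x.swap.swap y.swap.swap := hxy
      rwa [Sum.swap_swap, Sum.swap_swap] at hxy'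
    exact h2 ▸ hC.invol_mem _ h1

end Category

theorem generated_eq {k : ℕ} (hk : Even k) :
    generated {tensorPow (pairLower white white) (k / 2), wwbb} =
      {p | IsNCPair p ∧ (k : ℤ) ∣ cval p} := by
  refine (generated_subset hk).antisymm fun p hp C hC hS => ?_
  exact mem_of_dvd_cval hC (hS (Set.mem_insert_of_mem _ rfl)) hk (hS (Set.mem_insert _ _)) hp.1 hp.2

theorem dvd_of_generated_eq {k k' : ℕ} (hk : Even k) (hk' : Even k')
    (h : generated {tensorPow (pairLower white white) (k / 2), wwbb} =
      generated {tensorPow (pairLower white white) (k' / 2), wwbb}) : k' ∣ k := by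
  have h1 : tensorPow (pairLower white white) (k / 2) ∈
      generated {tensorPow (pairLower white white) (k / 2), wwbb} :=
    fun C _ hS => hS (Set.mem_insert _ _)
  rw [h, generated_eq hk'] at h1
  have h2 := h1.2
  rw [cval_tensorPow_pairLower hk] at h2
  exact Int.natCast_dvd_natCast.1 h2

/-- `⟨(∘∘)^{⊗k/2}, ∘∘⊗••⟩ = {p ∈ NC₂ | c(p) ∈ kℤ}` for even `k`, and these categories are
pairwise different. -/
theorem stmt_11 :
    (∀ k : ℕ, Even k →
        generated {tensorPow (pairLower white white) (k / 2), wwbb} =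
          {p : TCP | Noncrossing p ∧ (∀ x : Fin p.k ⊕ Fin p.l, blockSize p x = 2) ∧
            (k : ℤ) ∣ cval p}) ∧
    (∀ k k' : ℕ, Even k → Even k' →
        generated {tensorPow (pairLower white white) (k / 2), wwbb} =
          generated {tensorPow (pairLower white white) (k' / 2), wwbb} → k = k') := by
  have hset : ∀ k : ℕ, {p : TCP | Noncrossing p ∧
      (∀ x : Fin p.k ⊕ Fin p.l, blockSize p x = 2) ∧ (k : ℤ) ∣ cval p} =
      {p | IsNCPair p ∧ (k : ℤ) ∣ cval p} := by
    intro k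
    ext p
    rw [Set.mem_ofPred_eq, Set.mem_ofPred_eq, ← isPairing_iff_blockSize, IsNCPair, and_assoc]
  refine ⟨fun k hk => (generated_eq hk).trans (hset k).symm, fun k k' hk hk' h => ?_⟩
  exact Nat.dvd_antisymm (dvd_of_generated_eq hk' hk h.symm) (dvd_of_generated_eq hk hk' h)

end CTCP
end
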